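/- arXiv:2209.10947 — 5 statements merged into one kernel-verified Lean document; each statement's English description precedes it below -/
import Mathlib

section
/- Vectorial Gagliardo–Nirenberg inequality (inequality part of Proposition 3.1): Let d be an integer with 1 ≤ d ≤ 5, let κ > 0, and let α be a real number with 0 < α < min{2, d} and, in addition, α < (6−d)/2 if 3 ≤ d ≤ 5. Then there exists a constant C > 0 such that for all Schwartz functions u, v : ℝ^d → ℂ one has ℙ(u,v) ≤ C · 𝕂(u,v)^{(d+2α)/4} · 𝕄(u,v)^{(6−d−2α)/4}. -/
open MeasureTheory SchwartzMap

noncomputable section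

/-- Mass functional `𝕄(u,v) = ∫ |u|² + 2|v|²`. -/
def Mfun {d : ℕ} (u v : EuclideanSpace ℝ (Fin d) → ℂ) : ℝ :=
  ∫ x, (‖u x‖ ^ 2 + 2 * ‖v x‖ ^ 2)

/-- Kinetic functional `𝕂(u,v) = ∫ |∇u|² + κ|∇v|²`. -/
def Kfun {d : ℕ} (κ : ℝ) (u v : EuclideanSpace ℝ (Fin d) → ℂ) : ℝ :=
  ∫ x, (‖fderiv ℝ u x‖ ^ 2 + κ * ‖fderiv ℝ v x‖ ^ 2)

/-- Weighted potential functional `ℙ(u,v) = Re ∫ |x|^{-α} u² conj v`. -/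
def Pfun {d : ℕ} (α : ℝ) (u v : EuclideanSpace ℝ (Fin d) → ℂ) : ℝ :=
  (∫ x, (Complex.ofReal (‖x‖ ^ (-α)) * (u x) ^ 2 * (starRingEnd ℂ) (v x))).re

open scoped ENNReal NNReal
abbrev EE (d : ℕ) := EuclideanSpace ℝ (Fin d)

def GoodC (d : ℕ) (q : ℝ) : Prop := ∃ C : ℝ≥0∞, C ≠ ∞ ∧ ∀ f : EE d → ℂ, ContDiff ℝ 1 f →
  HasCompactSupport f → ∫⁻ x, ‖f x‖ₑ ^ 2 ≤ 1 → ∫⁻ x, ‖fderiv ℝ f x‖ₑ ^ 2 ≤ 1 →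
  ∫⁻ x, ‖f x‖ₑ ^ q ≤ C

lemma goodC_three (d : ℕ) (hd : 3 ≤ d) : GoodC d (2 * d / (d - 2)) := by
  have hd' : (3:ℝ) ≤ d := by exact_mod_cast hd
  have hq0 : (0:ℝ) < 2 * d / (d - 2) := div_pos (by linarith) (by linarith)
  set p' : ℝ≥0 := ⟨2 * d / (d - 2), hq0.le⟩ with hp'
  have hpc : (p' : ℝ) = 2 * d / (d - 2) := rfl
  refine ⟨(eLpNormLESNormFDerivOfEqInnerConst (volume : Measure (EE d)) (2:ℝ≥0) : ℝ≥0∞) ^ (p' : ℝ),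
    ENNReal.rpow_ne_top_of_nonneg p'.2 ENNReal.coe_ne_top, ?_⟩
  intro f hf hc h1 h2
  have h := eLpNorm_le_eLpNorm_fderiv_of_eq_inner (volume : Measure (EE d)) hf hc (p := 2) (p' := p')
    (by norm_num) (by simp; omega) (by
      rw [hpc]; simp
      have : (d:ℝ) - 2 ≠ 0 := by linarith
      field_simp)
  have hD : eLpNorm (fderiv ℝ f) (2:ℝ≥0) volume ≤ 1 := by
    rw [← ENNReal.rpow_le_rpow_iff (z := 2) (by norm_num)]
    have := eLpNorm_nnreal_pow_eq_lintegral (μ := (volume : Measure (EE d))) (f := fderiv ℝ f) (p := 2) (by norm_num)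
    norm_num at this ⊢
    rw [this]; exact h2
  have h3 := eLpNorm_nnreal_pow_eq_lintegral (μ := (volume : Measure (EE d))) (f := f) (p := p')
    (by rw [← NNReal.coe_ne_zero, hpc]; exact hq0.ne')
  rw [← hpc, ← h3]
  apply ENNReal.rpow_le_rpow _ p'.2
  exact h.trans (mul_le_of_le_one_right' hD)

lemma cs (d : ℕ) (f g : EE d → ℝ≥0∞) (hf : AEMeasurable f) (hg : AEMeasurable g) :
    (∫⁻ x, f x * g x) ^ 2 ≤ (∫⁻ x, f x ^ 2) * ∫⁻ x, g x ^ 2 := by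
  have := ENNReal.lintegral_mul_le_Lp_mul_Lq (volume : Measure (EE d)) Real.HolderConjugate.two_two hf hg
  have h2 := pow_le_pow_left' this 2
  simp only [Pi.mul_apply, ENNReal.rpow_two] at h2
  refine h2.trans_eq ?_
  rw [mul_pow, ← ENNReal.rpow_natCast, ← ENNReal.rpow_natCast, ← ENNReal.rpow_mul, ← ENNReal.rpow_mul]
  norm_num

lemma fderiv_pow_enorm (d : ℕ) (f : EE d → ℂ) (hf : ContDiff ℝ 1 f) (m : ℕ) (x : EE d) :
    ‖fderiv ℝ (fun x => f x ^ (m+1)) x‖ₑ ≤ (m+1) * (‖f x‖ₑ ^ m * ‖fderiv ℝ f x‖ₑ) := by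
  have h := ((hf.differentiable one_ne_zero) x).hasFDerivAt.pow (m+1)
  rw [h.fderiv, enorm_smul]
  simp only [add_tsub_cancel_right, enorm_pow, enorm_mul, nsmul_eq_mul]
  rw [mul_assoc]
  gcongr
  rw [← ofReal_norm, Complex.norm_natCast, ENNReal.ofReal_natCast]; push_cast; rfl

lemma pow_deriv (d : ℕ) (f : EE d → ℂ) (hf : ContDiff ℝ 1 f) (m : ℕ)
    (h2 : ∫⁻ x, ‖fderiv ℝ f x‖ₑ ^ 2 ≤ 1) :
    (∫⁻ x, ‖fderiv ℝ (fun x => f x ^ (m+1)) x‖ₑ) ^ 2 ≤ (m+1)^2 * ∫⁻ x, ‖f x‖ₑ ^ (2 * m) := by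
  have hc : Continuous (fderiv ℝ f) := hf.continuous_fderiv one_ne_zero
  have hc' := hf.continuous
  calc _ ≤ (∫⁻ x, (m+1) * (‖f x‖ₑ ^ m * ‖fderiv ℝ f x‖ₑ)) ^ 2 := by
        gcongr with x; exact fderiv_pow_enorm d f hf m x
    _ = (m+1)^2 * (∫⁻ x, (‖f x‖ₑ ^ m * ‖fderiv ℝ f x‖ₑ)) ^ 2 := by
        rw [lintegral_const_mul' _ _ (by finiteness), mul_pow]
    _ ≤ (m+1)^2 * ((∫⁻ x, (‖f x‖ₑ ^ m)^2) * ∫⁻ x, ‖fderiv ℝ f x‖ₑ^2) := by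
        gcongr
        exact cs d _ _ (by fun_prop) (by fun_prop)
    _ ≤ (m+1)^2 * ((∫⁻ x, (‖f x‖ₑ ^ m)^2) * 1) := by gcongr
    _ = _ := by simp_rw [mul_one, ← pow_mul, mul_comm m 2]

lemma goodC_two_aux (m : ℕ) :  ∃ C : ℝ≥0∞, C ≠ ∞ ∧ ∀ f : EE 2 → ℂ, ContDiff ℝ 1 f →
  HasCompactSupport f → ∫⁻ x, ‖f x‖ₑ ^ 2 ≤ 1 → ∫⁻ x, ‖fderiv ℝ f x‖ₑ ^ 2 ≤ 1 →
  ∫⁻ x, ‖f x‖ₑ ^ (2 * (m+1)) ≤ C := by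
  induction m with
  | zero => exact ⟨1, by simp, fun f _ _ h _ => by simpa using h⟩
  | succ m ih =>
    obtain ⟨C, hC, h⟩ := ih
    refine ⟨(lintegralPowLePowLIntegralFDerivConst (volume : Measure (EE 2)) 2) *
      (((m+1:ℕ)+1)^2 * C), by finiteness, ?_⟩
    intro f hf hc h1 h2
    have := lintegral_pow_le_pow_lintegral_fderiv (volume : Measure (EE 2))
      (u := fun x => f x ^ (m+1+1)) (p := 2) (hf.pow _) (by
        exact hc.comp_left (g := fun z => z ^ (m+1+1)) (by simp)) (by simpa using Real.HolderConjugate.two_two)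
    calc _ = ∫⁻ x, ‖f x ^ (m+1+1)‖ₑ ^ (2:ℝ) := by
            congr 1; ext x
            rw [enorm_pow, ENNReal.rpow_two, ← pow_mul, mul_comm]
      _ ≤ _ := this
      _ ≤ _ := by
        gcongr
        rw [ENNReal.rpow_two]
        refine (pow_deriv 2 f hf (m+1) h2).trans ?_
        gcongr
        exact h f hf hc h1 h2

lemma sup_one (f : EE 1 → ℂ) (hf : ContDiff ℝ 1 f) (hc : HasCompactSupport f) (x : EE 1) :
    ‖f x‖ₑ ≤ ∫⁻ y, ‖fderiv ℝ f y‖ₑ := by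
  let e : ℝ ≃ₗᵢ[ℝ] EE 1 := (OrthonormalBasis.singleton (Fin 1) ℝ).repr
  have he := e.measurePreserving
  rw [← he.lintegral_comp_emb e.toHomeomorph.measurableEmbedding]
  have hg : ContDiff ℝ 1 (f ∘ e) := hf.comp e.contDiff
  have := HasCompactSupport.enorm_le_lintegral_Ici_deriv hg (hc.comp_homeomorph e.toHomeomorph) (e.symm x)
  simp only [Function.comp_apply, LinearIsometryEquiv.apply_symm_apply] at this
  refine this.trans ((setLIntegral_le_lintegral _ _).trans ?_)
  gcongr with t
  have hd : HasDerivAt (f ∘ e) (fderiv ℝ f (e t) (e 1)) t := by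
    have h1 := ((hf.differentiable one_ne_zero) (e t)).hasFDerivAt
    have h2 : HasDerivAt e (e 1) t := by
      simpa using (e.toContinuousLinearEquiv.hasFDerivAt (x := t)).hasDerivAt
    exact h1.comp_hasDerivAt t h2
  rw [hd.deriv]
  refine (ContinuousLinearMap.le_opENorm _ _).trans ?_
  rw [← enorm_norm (e 1), e.norm_map]
  simp

lemma goodC_one_aux (m : ℕ) :  ∃ C : ℝ≥0∞, C ≠ ∞ ∧ ∀ f : EE 1 → ℂ, ContDiff ℝ 1 f →
  HasCompactSupport f → ∫⁻ x, ‖f x‖ₑ ^ 2 ≤ 1 → ∫⁻ x, ‖fderiv ℝ f x‖ₑ ^ 2 ≤ 1 →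
  ∫⁻ x, ‖f x‖ₑ ^ (2 * (m+1)) ≤ C := by
  refine ⟨2 ^ (2 * m), by finiteness, ?_⟩
  intro f hf hc h1 h2
  have hs : ∀ x, ‖f x‖ₑ ≤ 2 := by
    intro x
    have h := sup_one (fun x => f x ^ (1+1)) (hf.pow _) (hc.comp_left (g := fun z => z ^ (1+1)) (by simp)) x
    have h3 := (pow_deriv 1 f hf 1 h2)
    have h4 := (pow_le_pow_left' h 2).trans h3
    have h5 : (‖f x ^ (1+1)‖ₑ)^2 ≤ 2 ^ 4 := by
      refine h4.trans ?_
      calc _ ≤ ((1:ℕ) + 1 : ℝ≥0∞)^2 * 1 := by gcongr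
        _ ≤ _ := by
          have : ((1:ℕ) + 1 : ℝ≥0∞) = 2 := by norm_num
          rw [this, mul_one]
          exact pow_le_pow_right₀ (by norm_num) (by norm_num)
    rw [enorm_pow, ← pow_mul] at h5
    exact (ENNReal.pow_le_pow_left_iff (by norm_num)).1 h5
  calc _ ≤ ∫⁻ x, 2 ^ (2 * m) * ‖f x‖ₑ ^ 2 := by
        gcongr with x
        rw [mul_add, pow_add]
        gcongr
        exact hs x
    _ ≤ _ := by
      rw [lintegral_const_mul' _ _ (by finiteness)]
      exact mul_le_of_le_one_right' h1

lemma goodC_low (d : ℕ) (h1 : 1 ≤ d) (h2 : d ≤ 2) (m : ℕ) : GoodC d (2 * (m+1)) := by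
  have : ∃ C : ℝ≥0∞, C ≠ ∞ ∧ ∀ f : EE d → ℂ, ContDiff ℝ 1 f →
    HasCompactSupport f → ∫⁻ x, ‖f x‖ₑ ^ 2 ≤ 1 → ∫⁻ x, ‖fderiv ℝ f x‖ₑ ^ 2 ≤ 1 →
    ∫⁻ x, ‖f x‖ₑ ^ (2 * (m+1)) ≤ C := by
    interval_cases d
    · exact goodC_one_aux m
    · exact goodC_two_aux m
  unfold GoodC
  convert this using 10 with C f
  ext x
  rw [← ENNReal.rpow_natCast]; push_cast; rfl

def GoodA (d : ℕ) (q : ℝ) : Prop := ∃ C : ℝ≥0∞, C ≠ ∞ ∧ ∀ f : EE d → ℂ, ContDiff ℝ 1 f →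
  ∫⁻ x, ‖f x‖ₑ ^ 2 ≤ 1 → ∫⁻ x, ‖fderiv ℝ f x‖ₑ ^ 2 ≤ 1 →
  ∫⁻ x, ‖f x‖ₑ ^ q ≤ C

lemma enorm_sq_eq {V : Type*} [SeminormedAddCommGroup V] (v : V) :
    ‖v‖ₑ ^ 2 = ENNReal.ofReal (‖v‖ ^ 2) := by
  rw [← ofReal_norm, ENNReal.ofReal_pow (norm_nonneg _)]

lemma goodA_of_goodC (d : ℕ) (q : ℝ) (hq : 0 < q) (h : GoodC d q) : GoodA d q := by
  obtain ⟨C, hC, h⟩ := h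
  let χ : ContDiffBump (0 : EE d) := ⟨1, 2, by norm_num, by norm_num⟩
  have hχc : ContDiff ℝ 1 χ := χ.contDiff
  obtain ⟨L, hL⟩ : ∃ L, ∀ x, ‖fderiv ℝ χ x‖ ≤ L :=
    (χ.hasCompactSupport.fderiv (𝕜 := ℝ)).exists_bound_of_continuous (hχc.continuous_fderiv one_ne_zero)
  have hL0 : 0 ≤ L := (norm_nonneg _).trans (hL 0)
  set c : ℝ := 1 / (2 * (1 + L)) with hcdef
  have hc0 : 0 < c := by positivity
  have hcL : c * (1 + L) = 1 / 2 := by rw [hcdef]; field_simp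
  have hc1 : c ≤ 1 / 2 := by nlinarith
  have hcL' : c * L ≤ 1 / 2 := by nlinarith
  refine ⟨ENNReal.ofReal c⁻¹ ^ q * C, ENNReal.mul_ne_top (ENNReal.rpow_ne_top_of_nonneg hq.le (by simp)) hC, ?_⟩
  intro f hf h1 h2
  let r : ℕ → ℝ := fun n => ((n:ℝ) + 1)⁻¹
  have hr0 : ∀ n, 0 < r n := fun n => by positivity
  have hr1 : ∀ n, r n ≤ 1 := fun n => inv_le_one_of_one_le₀ (by linarith [(n.cast_nonneg : (0:ℝ) ≤ n)])
  let a : ℕ → EE d → ℝ := fun n x => c * χ (r n • x)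
  let g : ℕ → EE d → ℂ := fun n x => a n x • f x
  have ha : ∀ n x, |a n x| ≤ c := by
    intro n x
    rw [abs_of_nonneg (mul_nonneg hc0.le χ.nonneg)]
    exact mul_le_of_le_one_right hc0.le χ.le_one
  have haC : ∀ n, ContDiff ℝ 1 (a n) := fun n =>
    contDiff_const.mul (hχc.comp (contDiff_const_smul (r n)))
  have haD : ∀ n x, ‖fderiv ℝ (a n) x‖ ≤ c * L := by
    intro n x
    have : fderiv ℝ (a n) x = c • (r n • fderiv ℝ χ (r n • x)) := by
      rw [← fderiv_comp_smul]
      exact fderiv_const_mul ((hχc.comp (contDiff_const_smul (r n))).differentiable one_ne_zero x) c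
    rw [this, norm_smul, norm_smul, Real.norm_of_nonneg hc0.le, Real.norm_of_nonneg (hr0 n).le]
    gcongr
    calc _ ≤ 1 * L := by
          gcongr
          · exact hr1 n
          · exact hL _
      _ = L := one_mul L
  have hgC : ∀ n, ContDiff ℝ 1 (g n) := fun n => (haC n).smul hf
  have hgs : ∀ n, HasCompactSupport (g n) := by
    intro n
    have h1 : HasCompactSupport (fun x => χ (r n • x)) :=
      χ.hasCompactSupport.comp_smul (hr0 n).ne'
    have h2 : HasCompactSupport (a n) := h1.mul_left (f := fun _ => c)
    exact h2.smul_right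
  have hg : ∀ n, ∫⁻ x, ‖g n x‖ₑ ^ q ≤ C := by
    intro n
    refine h _ (hgC n) (hgs n) ?_ ?_
    · refine le_trans ?_ h1
      gcongr with x
      simp only [g]
      rw [enorm_smul]
      refine mul_le_of_le_one_left' ?_
      rw [← ofReal_norm, ENNReal.ofReal_le_one, Real.norm_eq_abs]
      exact (ha n x).trans (by linarith)
    · have key : ∀ x, ‖fderiv ℝ (g n) x‖ₑ ^ 2 ≤
          2⁻¹ * ‖fderiv ℝ f x‖ₑ ^ 2 + 2⁻¹ * ‖f x‖ₑ ^ 2 := by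
        intro x
        have e2 : (2⁻¹ : ℝ≥0∞) = ENNReal.ofReal (1/2) := by
          rw [one_div, ENNReal.ofReal_inv_of_pos (by norm_num)]; simp
        rw [enorm_sq_eq, enorm_sq_eq, enorm_sq_eq, e2, ← ENNReal.ofReal_mul (by norm_num),
          ← ENNReal.ofReal_mul (by norm_num), ← ENNReal.ofReal_add (by positivity) (by positivity)]
        apply ENNReal.ofReal_le_ofReal
        have hd := (((haC n).differentiable one_ne_zero x).hasFDerivAt.smul
          (hf.differentiable one_ne_zero x).hasFDerivAt).fderiv
        have hb : ‖fderiv ℝ (g n) x‖ ≤ 1/2 * ‖fderiv ℝ f x‖ + 1/2 * ‖f x‖ := by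
          have : fderiv ℝ (g n) x = _ := hd
          rw [this]
          refine (norm_add_le _ _).trans ?_
          rw [norm_smul, ContinuousLinearMap.norm_smulRight_apply, Real.norm_eq_abs]
          gcongr
          · exact (ha n x).trans hc1
          · exact (haD n x).trans hcL'
        nlinarith [norm_nonneg (fderiv ℝ (g n) x), norm_nonneg (fderiv ℝ f x), norm_nonneg (f x),
          sq_nonneg (‖fderiv ℝ f x‖ - ‖f x‖)]
      calc _ ≤ ∫⁻ x, (2⁻¹ * ‖fderiv ℝ f x‖ₑ ^ 2 + 2⁻¹ * ‖f x‖ₑ ^ 2) := lintegral_mono key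
        _ = 2⁻¹ * (∫⁻ x, ‖fderiv ℝ f x‖ₑ ^ 2) + 2⁻¹ * ∫⁻ x, ‖f x‖ₑ ^ 2 := by
          have := hf.continuous
          rw [lintegral_add_right _ (by fun_prop), lintegral_const_mul' _ _ (by simp),
            lintegral_const_mul' _ _ (by simp)]
        _ ≤ 2⁻¹ * 1 + 2⁻¹ * 1 := by gcongr
        _ = 1 := by simp [ENNReal.inv_two_add_inv_two]
  have hlim : ∀ x, Filter.Tendsto (fun n => ‖g n x‖ₑ ^ q) Filter.atTop
      (nhds (‖c • f x‖ₑ ^ q)) := by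
    intro x
    apply tendsto_const_nhds.congr'
    obtain ⟨N, hN⟩ := exists_nat_ge ‖x‖
    filter_upwards [Filter.eventually_ge_atTop N] with n hn
    have : χ (r n • x) = 1 := by
      apply χ.one_of_mem_closedBall
      simp only [mem_closedBall_zero_iff, norm_smul, Real.norm_of_nonneg (hr0 n).le]
      have : (N:ℝ) ≤ n := by exact_mod_cast hn
      change ((n:ℝ)+1)⁻¹ * ‖x‖ ≤ 1
      rw [inv_mul_le_iff₀ (by positivity)]
      linarith
    simp [g, a, this]
  have hF : ∫⁻ x, ‖c • f x‖ₑ ^ q ≤ C := by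
    calc _ = ∫⁻ x, Filter.liminf (fun n => ‖g n x‖ₑ ^ q) Filter.atTop := by
          congr 1; ext x; exact (hlim x).liminf_eq.symm
      _ ≤ Filter.liminf (fun n => ∫⁻ x, ‖g n x‖ₑ ^ q) Filter.atTop :=
          lintegral_liminf_le fun n => by
            have := (hgC n).continuous
            fun_prop
      _ ≤ C := by
          refine (Filter.liminf_le_liminf (Filter.Eventually.of_forall hg)).trans ?_
          simp
  calc _ = ∫⁻ x, ENNReal.ofReal c⁻¹ ^ q * ‖c • f x‖ₑ ^ q := by
        congr 1; ext x
        rw [← ENNReal.mul_rpow_of_nonneg _ _ hq.le, enorm_smul, ← mul_assoc, ← ofReal_norm (c:ℝ),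
          Real.norm_of_nonneg hc0.le, ← ENNReal.ofReal_mul (by positivity), inv_mul_cancel₀ hc0.ne']
        simp
    _ = _ := lintegral_const_mul' _ _ (ENNReal.rpow_ne_top_of_nonneg hq.le (by simp))
    _ ≤ _ := by gcongr

lemma weighted (d : ℕ) (hd : 1 ≤ d) (q α : ℝ) (hq : 3 < q) (hα : 0 < α)
    (hαq : α * (q / (q - 3)) < d) (h : GoodA d q) :
    ∃ C : ℝ≥0∞, C ≠ ∞ ∧ ∀ f : EE d → ℂ, ContDiff ℝ 1 f →
      ∫⁻ x, ‖f x‖ₑ ^ 2 ≤ 1 → ∫⁻ x, ‖fderiv ℝ f x‖ₑ ^ 2 ≤ 1 →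
      ∫⁻ x, ENNReal.ofReal (‖x‖ ^ (-α) * ‖f x‖ ^ 3) ≤ C := by
  obtain ⟨C, hC, h⟩ := h
  set a := q / (q - 3) with ha
  have hq3 : 0 < q - 3 := by linarith
  have hconj : a.HolderConjugate (q / 3) := by
    rw [Real.holderConjugate_iff]
    constructor
    · rw [ha, lt_div_iff₀ hq3]; linarith
    · rw [ha]; field_simp; ring
  have hI : IntegrableOn (fun x : EE d => ‖x‖ ^ (-(α * a))) (Metric.ball 0 1) := by
    apply integrableOn_ball_of_norm_le_rpow (by simpa using hd) (C := 1) (α := α * a) (by simpa using hαq)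
    · refine Filter.Eventually.of_forall fun x => ?_
      rw [one_mul, Real.norm_of_nonneg (by positivity)]
    · exact (measurable_norm.pow_const _).aestronglyMeasurable
  have hI' := hI.lintegral_lt_top
  refine ⟨(∫⁻ x in Metric.ball (0 : EE d) 1, ENNReal.ofReal (‖x‖ ^ (-(α * a)))) + (1 + C),
    by finiteness, ?_⟩
  intro f hf h1 h2
  have key : ∀ x, ENNReal.ofReal (‖x‖ ^ (-α) * ‖f x‖ ^ 3) ≤
      (Metric.ball (0 : EE d) 1).indicator (fun x => ENNReal.ofReal (‖x‖ ^ (-(α * a)))) x +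
        (‖f x‖ₑ ^ 2 + ‖f x‖ₑ ^ q) := by
    intro x
    have e3 : ‖f x‖ₑ ^ q = ENNReal.ofReal (‖f x‖ ^ q) := by
      rw [← ofReal_norm, ENNReal.ofReal_rpow_of_nonneg (norm_nonneg _) (by linarith)]
    rw [enorm_sq_eq, e3, ← ENNReal.ofReal_add (by positivity) (by positivity)]
    by_cases hx : x ∈ Metric.ball (0 : EE d) 1
    · rw [Set.indicator_of_mem hx, ← ENNReal.ofReal_add (by positivity) (by positivity)]
      apply ENNReal.ofReal_le_ofReal
      have hy := Real.young_inequality_of_nonneg (a := ‖x‖ ^ (-α)) (b := ‖f x‖ ^ 3)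
        (by positivity) (by positivity) hconj
      have e1 : (‖x‖ ^ (-α)) ^ a = ‖x‖ ^ (-(α * a)) := by
        rw [← Real.rpow_mul (norm_nonneg _), neg_mul]
      have e2 : (‖f x‖ ^ 3) ^ (q/3) = ‖f x‖ ^ q := by
        rw [← Real.rpow_natCast, ← Real.rpow_mul (norm_nonneg _)]; congr 1; push_cast; ring
      rw [e1, e2] at hy
      have i1 := div_le_self (a := ‖x‖ ^ (-(α * a))) (by positivity) hconj.lt.le
      have i2 := div_le_self (a := ‖f x‖ ^ q) (by positivity) hconj.symm.lt.le
      have i3 : 0 ≤ ‖f x‖ ^ 2 := by positivity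
      linarith
    · rw [Set.indicator_of_notMem hx, zero_add]
      apply ENNReal.ofReal_le_ofReal
      have hx1 : 1 ≤ ‖x‖ := by simpa using hx
      have hw : ‖x‖ ^ (-α) ≤ 1 := Real.rpow_le_one_of_one_le_of_nonpos hx1 (by linarith)
      have i0 : ‖x‖ ^ (-α) * ‖f x‖ ^ 3 ≤ ‖f x‖ ^ 3 := mul_le_of_le_one_left (by positivity) hw
      refine i0.trans ?_
      have i3 : 0 ≤ ‖f x‖ ^ 2 := by positivity
      have i4 : 0 ≤ ‖f x‖ ^ q := by positivity
      rcases le_total ‖f x‖ 1 with hl | hl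
      · have := pow_le_pow_of_le_one (norm_nonneg (f x)) hl (by norm_num : 2 ≤ 3)
        linarith
      · have := Real.rpow_le_rpow_of_exponent_le hl hq.le
        have e : ‖f x‖ ^ (3:ℝ) = ‖f x‖ ^ (3:ℕ) := by exact_mod_cast Real.rpow_natCast ‖f x‖ 3
        rw [e] at this
        linarith
  have hfc := hf.continuous
  calc _ ≤ _ := lintegral_mono key
    _ = (∫⁻ x in Metric.ball (0 : EE d) 1, ENNReal.ofReal (‖x‖ ^ (-(α * a)))) +
        ((∫⁻ x, ‖f x‖ₑ ^ 2) + ∫⁻ x, ‖f x‖ₑ ^ q) := by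
      rw [lintegral_add_right _ (by fun_prop), lintegral_indicator measurableSet_ball,
        lintegral_add_right _ (by fun_prop)]
    _ ≤ _ := by gcongr; exact h f hf h1 h2

lemma lint_smul (d : ℕ) (r : ℝ) (hr : 0 < r) (F : EE d → ℝ≥0∞) :
    ∫⁻ x, F (r • x) = ENNReal.ofReal ((r ^ d)⁻¹) * ∫⁻ x, F x := by
  have h := Measure.map_addHaar_smul (volume : Measure (EE d)) hr.ne'
  have he : MeasurableEmbedding (fun x : EE d => r • x) :=
    (Homeomorph.smulOfNeZero r hr.ne').measurableEmbedding
  rw [← he.lintegral_map, h, lintegral_smul_measure, abs_of_pos (by positivity)]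
  simp

lemma scaled (d : ℕ) (α : ℝ)
    (h : ∃ C : ℝ≥0∞, C ≠ ∞ ∧ ∀ f : EE d → ℂ, ContDiff ℝ 1 f →
      ∫⁻ x, ‖f x‖ₑ ^ 2 ≤ 1 → ∫⁻ x, ‖fderiv ℝ f x‖ₑ ^ 2 ≤ 1 →
      ∫⁻ x, ENNReal.ofReal (‖x‖ ^ (-α) * ‖f x‖ ^ 3) ≤ C) :
    ∃ C : ℝ, 0 < C ∧ ∀ f : EE d → ℂ, ContDiff ℝ 1 f → ∀ k m : ℝ, 0 < k → 0 < m →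
      ∫⁻ x, ‖f x‖ₑ ^ 2 ≤ ENNReal.ofReal m → ∫⁻ x, ‖fderiv ℝ f x‖ₑ ^ 2 ≤ ENNReal.ofReal k →
      ∫⁻ x, ENNReal.ofReal (‖x‖ ^ (-α) * ‖f x‖ ^ 3) ≤
        ENNReal.ofReal (C * k ^ (((d : ℝ) + 2 * α) / 4) * m ^ ((6 - (d : ℝ) - 2 * α) / 4)) := by
  obtain ⟨C, hC, h⟩ := h
  refine ⟨C.toReal + 1, by positivity, ?_⟩
  intro f hf k m hk hm h1 h2
  obtain ⟨a, rfl⟩ : ∃ a, m = Real.exp a := ⟨Real.log m, (Real.exp_log hm).symm⟩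
  obtain ⟨b, rfl⟩ : ∃ b, k = Real.exp b := ⟨Real.log k, (Real.exp_log hk).symm⟩
  set l := (a - b) / 2 with hl
  set r := Real.exp l with hr
  set μ := Real.exp ((d * l - a) / 2) with hμ
  have hr0 : 0 < r := Real.exp_pos _
  have hμ0 : 0 < μ := Real.exp_pos _
  have hrd : r ^ d = Real.exp (d * l) := by rw [hr, ← Real.exp_nat_mul]
  let g : EE d → ℂ := fun x => μ • f (r • x)
  have hg : ContDiff ℝ 1 g := (hf.comp (contDiff_const_smul r)).const_smul μ
  have hgd : ∀ x, fderiv ℝ g x = (μ * r) • fderiv ℝ f (r • x) := by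
    intro x
    rw [mul_smul, ← fderiv_comp_smul]
    exact fderiv_const_smul ((hf.comp (contDiff_const_smul r)).differentiable one_ne_zero x) μ
  have g1 : ∫⁻ x, ‖g x‖ₑ ^ 2 ≤ 1 := by
    calc _ = ∫⁻ x, ENNReal.ofReal (μ ^ 2) * ‖f (r • x)‖ₑ ^ 2 := by
          congr 1; ext x
          simp only [g]
          rw [enorm_smul, mul_pow, enorm_sq_eq μ, Real.norm_of_nonneg hμ0.le]
      _ = ENNReal.ofReal (μ ^ 2) * (ENNReal.ofReal ((r ^ d)⁻¹) * ∫⁻ x, ‖f x‖ₑ ^ 2) := by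
          rw [lintegral_const_mul' _ _ (by simp), lint_smul d r hr0 (fun x => ‖f x‖ₑ ^ 2)]
      _ ≤ ENNReal.ofReal (μ ^ 2) * (ENNReal.ofReal ((r ^ d)⁻¹) * ENNReal.ofReal (Real.exp a)) := by
          gcongr
      _ = 1 := by
          rw [← ENNReal.ofReal_mul (by positivity), ← ENNReal.ofReal_mul (by positivity), hrd, hμ,
            ← Real.exp_neg, ← Real.exp_nat_mul, ← Real.exp_add, ← Real.exp_add,
            ← ENNReal.ofReal_one, ← Real.exp_zero]
          congr 2; push_cast; ring
  have g2 : ∫⁻ x, ‖fderiv ℝ g x‖ₑ ^ 2 ≤ 1 := by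
    calc _ = ∫⁻ x, ENNReal.ofReal ((μ * r) ^ 2) * ‖fderiv ℝ f (r • x)‖ₑ ^ 2 := by
          congr 1; ext x
          rw [hgd, enorm_smul, mul_pow, enorm_sq_eq (μ * r), Real.norm_of_nonneg (by positivity)]
      _ = ENNReal.ofReal ((μ * r) ^ 2) * (ENNReal.ofReal ((r ^ d)⁻¹) * ∫⁻ x, ‖fderiv ℝ f x‖ₑ ^ 2) := by
          rw [lintegral_const_mul' _ _ (by simp), lint_smul d r hr0 (fun x => ‖fderiv ℝ f x‖ₑ ^ 2)]
      _ ≤ ENNReal.ofReal ((μ * r) ^ 2) * (ENNReal.ofReal ((r ^ d)⁻¹) * ENNReal.ofReal (Real.exp b)) := by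
          gcongr
      _ = 1 := by
          rw [← ENNReal.ofReal_mul (by positivity), ← ENNReal.ofReal_mul (by positivity), hrd, hμ, hr,
            ← Real.exp_neg, ← Real.exp_add, ← Real.exp_nat_mul, ← Real.exp_add, ← Real.exp_add,
            ← ENNReal.ofReal_one, ← Real.exp_zero]
          congr 2; push_cast; rw [hl]; ring
  have g3 := h g hg g1 g2
  have e : ∫⁻ x, ENNReal.ofReal (‖x‖ ^ (-α) * ‖g x‖ ^ 3) =
      ENNReal.ofReal (μ ^ 3 * r ^ α * (r ^ d)⁻¹) *
        ∫⁻ x, ENNReal.ofReal (‖x‖ ^ (-α) * ‖f x‖ ^ 3) := by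
    calc _ = ∫⁻ x, ENNReal.ofReal (μ ^ 3 * r ^ α) *
          ENNReal.ofReal (‖r • x‖ ^ (-α) * ‖f (r • x)‖ ^ 3) := by
          congr 1; ext x
          rw [← ENNReal.ofReal_mul (by positivity)]
          simp only [g]
          rw [norm_smul, norm_smul, Real.norm_of_nonneg hμ0.le, Real.norm_of_nonneg hr0.le,
            Real.mul_rpow hr0.le (norm_nonneg _), Real.rpow_neg hr0.le]
          congr 1
          have : r ^ α ≠ 0 := by positivity
          field_simp
      _ = _ := by
          rw [lintegral_const_mul' _ _ (by simp),
            lint_smul d r hr0 (fun x => ENNReal.ofReal (‖x‖ ^ (-α) * ‖f x‖ ^ 3)), ← mul_assoc,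
            ← ENNReal.ofReal_mul (by positivity)]
  rw [e] at g3
  set s := μ ^ 3 * r ^ α * (r ^ d)⁻¹ with hs
  have hs0 : 0 < s := by positivity
  have hsv : s⁻¹ = Real.exp b ^ (((d : ℝ) + 2 * α) / 4) * Real.exp a ^ ((6 - (d : ℝ) - 2 * α) / 4) := by
    rw [hs, hrd, hμ, hr, ← Real.exp_mul, ← Real.exp_mul, ← Real.exp_mul, ← Real.exp_nat_mul,
      ← Real.exp_neg, ← Real.exp_add, ← Real.exp_add, ← Real.exp_add, ← Real.exp_neg]
    congr 1; push_cast; rw [hl]; ring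
  rw [mul_assoc, ← hsv]
  calc _ = ENNReal.ofReal s⁻¹ * (ENNReal.ofReal s *
        ∫⁻ x, ENNReal.ofReal (‖x‖ ^ (-α) * ‖f x‖ ^ 3)) := by
        rw [← mul_assoc, ← ENNReal.ofReal_mul (by positivity), inv_mul_cancel₀ hs0.ne']; simp
    _ ≤ ENNReal.ofReal s⁻¹ * C := by gcongr
    _ ≤ ENNReal.ofReal s⁻¹ * ENNReal.ofReal (C.toReal + 1) := by
        gcongr
        rw [← ENNReal.ofReal_toReal hC]
        apply ENNReal.ofReal_le_ofReal
        rw [ENNReal.toReal_ofReal (by positivity)]; linarith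
    _ = _ := by rw [mul_comm, ← ENNReal.ofReal_mul (by positivity)]

lemma scalar_gn (d : ℕ) (hd1 : 1 ≤ d) (hd5 : d ≤ 5) (α : ℝ)
    (hα0 : 0 < α) (hα1 : α < min 2 (d : ℝ))
    (hα2 : 3 ≤ d → α < (6 - (d : ℝ)) / 2) :
    ∃ C : ℝ, 0 < C ∧ ∀ f : EE d → ℂ, ContDiff ℝ 1 f → ∀ k m : ℝ, 0 < k → 0 < m →
      ∫⁻ x, ‖f x‖ₑ ^ 2 ≤ ENNReal.ofReal m → ∫⁻ x, ‖fderiv ℝ f x‖ₑ ^ 2 ≤ ENNReal.ofReal k →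
      ∫⁻ x, ENNReal.ofReal (‖x‖ ^ (-α) * ‖f x‖ ^ 3) ≤
        ENNReal.ofReal (C * k ^ (((d : ℝ) + 2 * α) / 4) * m ^ ((6 - (d : ℝ) - 2 * α) / 4)) := by
  apply scaled
  have hαd := hα1.trans_le (min_le_right _ _)
  by_cases hd : 3 ≤ d
  · have hd' : (3:ℝ) ≤ d := by exact_mod_cast hd
    have hd5' : (d:ℝ) ≤ 5 := by exact_mod_cast hd5
    have h2 : 0 < (d:ℝ) - 2 := by linarith
    have hq : (3:ℝ) < 2 * d / (d - 2) := by rw [lt_div_iff₀ h2]; linarith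
    refine weighted d hd1 _ α hq hα0 ?_ (goodA_of_goodC d _ (by linarith) (goodC_three d hd))
    have h6 : 0 < 6 - (d:ℝ) := by linarith
    have : (2 * d / (d - 2) : ℝ) / (2 * d / (d - 2) - 3) = 2 * d / (6 - d) := by
      have : (2 * d / (d - 2) - 3 : ℝ) = (6 - d) / (d - 2) := by field_simp; ring
      rw [this]; field_simp
    rw [this, ← mul_div_assoc, div_lt_iff₀ h6]
    have := hα2 hd
    nlinarith
  · obtain ⟨n, hn⟩ := exists_nat_gt (3 * d / (d - α))
    have hda : 0 < (d:ℝ) - α := by linarith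
    rw [div_lt_iff₀ hda] at hn
    have hn0 : (0:ℝ) ≤ n := n.cast_nonneg
    have hq : (3:ℝ) < 2 * ((n + 1 : ℕ) + 1) := by push_cast; linarith
    refine weighted d hd1 _ α hq hα0 ?_ (goodA_of_goodC d _ (by linarith)
      (goodC_low d hd1 (by omega) (n+1)))
    rw [← mul_div_assoc, div_lt_iff₀ (by linarith)]
    push_cast
    nlinarith

lemma lint_sq_le {V : Type*} [NormedAddCommGroup V] (d : ℕ) (F : EE d → V)
    (hF : Integrable (fun x => ‖F x‖ ^ 2)) {m : ℝ}
    (hm : ∫ x, ‖F x‖ ^ 2 ≤ m) : ∫⁻ x, ‖F x‖ₑ ^ 2 ≤ ENNReal.ofReal m := by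
  simp_rw [enorm_sq_eq]
  rw [← ofReal_integral_eq_lintegral_ofReal hF (Filter.Eventually.of_forall fun x => by positivity)]
  exact ENNReal.ofReal_le_ofReal hm

/-- Vectorial Gagliardo–Nirenberg inequality (Proposition 3.1, inequality part). -/
theorem vectorial_gagliardo_nirenberg
    (d : ℕ) (hd1 : 1 ≤ d) (hd5 : d ≤ 5) (κ α : ℝ) (hκ : 0 < κ)
    (hα0 : 0 < α) (hα1 : α < min 2 (d : ℝ))
    (hα2 : 3 ≤ d → α < (6 - (d : ℝ)) / 2) :
    ∃ C > 0, ∀ u v : SchwartzMap (EuclideanSpace ℝ (Fin d)) ℂ,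
      Pfun α (⇑u) (⇑v) ≤
        C * (Kfun κ (⇑u) (⇑v)) ^ (((d : ℝ) + 2 * α) / 4)
          * (Mfun (⇑u) (⇑v)) ^ ((6 - (d : ℝ) - 2 * α) / 4) := by
  obtain ⟨C, hC, h⟩ := scalar_gn d hd1 hd5 α hα0 hα1 hα2
  have hs0 : 0 < ((d : ℝ) + 2 * α) / 4 := by positivity
  have ht0 : 0 < (6 - (d : ℝ) - 2 * α) / 4 := by
    by_cases hd : 3 ≤ d
    · have := hα2 hd; linarith
    · have hd2 : (d:ℝ) ≤ 2 := by exact_mod_cast (by omega : d ≤ 2)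
      have := hα1.trans_le (min_le_left _ _)
      have := hα1.trans_le (min_le_right _ _)
      linarith
  set s := ((d : ℝ) + 2 * α) / 4 with hs
  set t := (6 - (d : ℝ) - 2 * α) / 4 with ht
  have hB : 0 < 1 + κ⁻¹ := by positivity
  refine ⟨2 * C * (1 + κ⁻¹) ^ s, by positivity, ?_⟩
  intro u v
  have iu : Integrable (fun x => ‖u x‖ ^ 2) := (u.memLp 2).integrable_norm_pow (by norm_num)
  have iv : Integrable (fun x => ‖v x‖ ^ 2) := (v.memLp 2).integrable_norm_pow (by norm_num)
  have idu : Integrable (fun x => ‖fderiv ℝ u x‖ ^ 2) :=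
    MemLp.integrable_norm_pow (p := 2) (f := fderiv ℝ u)
      ((SchwartzMap.fderivCLM ℝ (EuclideanSpace ℝ (Fin d)) ℂ u).memLp 2 volume) (by norm_num)
  have idv : Integrable (fun x => ‖fderiv ℝ v x‖ ^ 2) :=
    MemLp.integrable_norm_pow (p := 2) (f := fderiv ℝ v)
      ((SchwartzMap.fderivCLM ℝ (EuclideanSpace ℝ (Fin d)) ℂ v).memLp 2 volume) (by norm_num)
  have nu : 0 ≤ ∫ x, ‖u x‖ ^ 2 := integral_nonneg fun x => by positivity
  have nv : 0 ≤ ∫ x, ‖v x‖ ^ 2 := integral_nonneg fun x => by positivity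
  have ndu : 0 ≤ ∫ x, ‖fderiv ℝ u x‖ ^ 2 := integral_nonneg fun x => by positivity
  have ndv : 0 ≤ ∫ x, ‖fderiv ℝ v x‖ ^ 2 := integral_nonneg fun x => by positivity
  have hM : Mfun u v = (∫ x, ‖u x‖ ^ 2) + 2 * ∫ x, ‖v x‖ ^ 2 := by
    unfold Mfun
    rw [integral_add iu (iv.const_mul 2), integral_const_mul]
  have hK : Kfun κ u v = (∫ x, ‖fderiv ℝ u x‖ ^ 2) + κ * ∫ x, ‖fderiv ℝ v x‖ ^ 2 := by
    unfold Kfun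
    rw [integral_add idu (idv.const_mul κ), integral_const_mul]
  have hM0 : 0 ≤ Mfun u v := by rw [hM]; positivity
  have hK0 : 0 ≤ Kfun κ u v := by rw [hK]; positivity
  have hmain : ∀ ε : ℝ, 0 < ε → Pfun α u v ≤
      2 * C * (1 + κ⁻¹) ^ s * (Kfun κ u v + ε) ^ s * (Mfun u v + ε) ^ t := by
    intro ε hε
    have hk : 0 < (1 + κ⁻¹) * (Kfun κ u v + ε) := by positivity
    have hm : 0 < Mfun u v + ε := by positivity
    have hKe : ∀ z : ℝ, z ≤ Kfun κ u v ∨ z ≤ κ⁻¹ * Kfun κ u v →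
        z ≤ (1 + κ⁻¹) * (Kfun κ u v + ε) := by
      intro z hz
      have : 0 ≤ κ⁻¹ * Kfun κ u v := by positivity
      have : 0 < κ⁻¹ * ε := by positivity
      rcases hz with hz | hz <;> nlinarith
    have hu := h u (u.smooth 1) _ _ hk hm (lint_sq_le d u iu (by rw [hM]; linarith))
      (lint_sq_le d _ idu (hKe _ (Or.inl (by rw [hK]; nlinarith))))
    have hv := h v (v.smooth 1) _ _ hk hm (lint_sq_le d v iv (by rw [hM]; linarith))
      (lint_sq_le d _ idv (hKe _ (Or.inr (by
        rw [hK, mul_add, inv_mul_cancel_left₀ hκ.ne']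
        have : 0 ≤ κ⁻¹ * ∫ x, ‖fderiv ℝ u x‖ ^ 2 := by positivity
        linarith))))
    set R := C * ((1 + κ⁻¹) * (Kfun κ u v + ε)) ^ s * (Mfun u v + ε) ^ t with hR
    have hR0 : 0 ≤ R := by positivity
    have hle : ∫⁻ x, ENNReal.ofReal ‖Complex.ofReal (‖x‖ ^ (-α)) * (u x) ^ 2 * (starRingEnd ℂ) (v x)‖
        ≤ ENNReal.ofReal (2 * R) := by
      have huc := u.continuous
      have hvc := v.continuous
      calc _ ≤ ∫⁻ x, (ENNReal.ofReal (‖x‖ ^ (-α) * ‖u x‖ ^ 3) +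
            ENNReal.ofReal (‖x‖ ^ (-α) * ‖v x‖ ^ 3)) := by
            gcongr with x
            rw [← ENNReal.ofReal_add (by positivity) (by positivity)]
            apply ENNReal.ofReal_le_ofReal
            rw [norm_mul, norm_mul, norm_pow, RCLike.norm_conj, Complex.norm_real,
              Real.norm_of_nonneg (by positivity), mul_assoc, ← mul_add]
            gcongr
            have a0 := norm_nonneg (u x)
            have b0 := norm_nonneg (v x)
            rcases le_total ‖u x‖ ‖v x‖ with hl | hl
            · nlinarith [pow_le_pow_left₀ a0 hl 2, pow_nonneg a0 3]
            · nlinarith [pow_le_pow_left₀ b0 hl 2, pow_nonneg b0 3,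
                mul_le_mul_of_nonneg_left hl (sq_nonneg ‖u x‖)]
        _ = _ := lintegral_add_right _ (by
            refine ENNReal.measurable_ofReal.comp ?_
            exact (measurable_norm.pow_const _).mul (by fun_prop))
        _ ≤ ENNReal.ofReal R + ENNReal.ofReal R := add_le_add hu hv
        _ = _ := by rw [← ENNReal.ofReal_add hR0 hR0, two_mul]
    calc Pfun α u v ≤ ‖∫ x, (Complex.ofReal (‖x‖ ^ (-α)) * (u x) ^ 2 * (starRingEnd ℂ) (v x))‖ :=
          Complex.re_le_norm _
      _ ≤ _ := norm_integral_le_lintegral_norm _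
      _ ≤ (ENNReal.ofReal (2 * R)).toReal := ENNReal.toReal_mono ENNReal.ofReal_ne_top hle
      _ = 2 * R := ENNReal.toReal_ofReal (by positivity)
      _ = _ := by
        rw [hR, Real.mul_rpow hB.le (by positivity)]; ring
  have hcont : Continuous (fun ε : ℝ =>
      2 * C * (1 + κ⁻¹) ^ s * (Kfun κ u v + ε) ^ s * (Mfun u v + ε) ^ t) := by
    have c1 : Continuous fun ε : ℝ => (Kfun κ u v + ε) ^ s :=
      (continuous_const.add continuous_id).rpow_const fun _ => Or.inr hs0.le
    have c2 : Continuous fun ε : ℝ => (Mfun u v + ε) ^ t :=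
      (continuous_const.add continuous_id).rpow_const fun _ => Or.inr ht0.le
    exact (continuous_const.mul c1).mul c2
  have hlim := (hcont.tendsto 0).mono_left (nhdsWithin_le_nhds (s := Set.Ioi (0:ℝ)))
  simp only [add_zero] at hlim
  refine ge_of_tendsto hlim ?_
  filter_upwards [self_mem_nhdsWithin] with ε hε
  exact hmain ε hε

end
end

section
/- Scalar weighted Gagliardo–Nirenberg inequality (inequality part of Proposition 3.2): Let d be an integer with 1 ≤ d ≤ 5 and let α be a real number with 0 < α < min{2, d} and, in addition, α < (6−d)/2 if 3 ≤ d ≤ 5. Then there exists a constant C > 0 such that for every Schwartz function f : ℝ^d → ℂ one has ∫_{ℝ^d} |x|^{−α} |f(x)|³ dx ≤ C · ‖∇f‖_{L²}^{(d+2α)/2} · ‖f‖_{L²}^{(6−d−2α)/2}. -/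
open MeasureTheory SchwartzMap

noncomputable section

open scoped ENNReal NNReal

/-- The unweighted Gagliardo-Nirenberg inequality for compactly supported functions. -/
def GNI (d : ℕ) (p : ℝ) : Prop :=
  ∃ C : ℝ≥0∞, C ≠ ⊤ ∧ ∀ u : EuclideanSpace ℝ (Fin d) → ℂ, ContDiff ℝ 1 u → HasCompactSupport u →
    ∫⁻ x, ‖u x‖ₑ ^ p ≤ C * (∫⁻ x, ‖fderiv ℝ u x‖ₑ ^ (2 : ℝ)) ^ ((d : ℝ) * (p - 2) / 4)
      * (∫⁻ x, ‖u x‖ₑ ^ (2 : ℝ)) ^ (p / 2 - (d : ℝ) * (p - 2) / 4)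

lemma GNI_interp (d : ℕ) (q : ℝ) (hq : 3 < q) (h : GNI d q)
    (hexp : 0 ≤ q / 2 - (d : ℝ) * (q - 2) / 4) : GNI d 3 := by
  obtain ⟨C, hC, h⟩ := h
  have hq2 : 0 < q - 2 := by linarith
  set b : ℝ := 1 / (q - 2) with hb
  have hb0 : 0 ≤ b := by positivity
  have hbq : b * (q - 2) = 1 := by rw [hb]; field_simp
  have hb1 : b ≤ 1 := by nlinarith
  have he : 0 ≤ (d : ℝ) * (q - 2) / 4 := by positivity
  refine ⟨C ^ b, ENNReal.rpow_ne_top_of_nonneg hb0 hC, fun u hu hcu => ?_⟩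
  have hm : Measurable u := hu.continuous.measurable
  calc ∫⁻ x, ‖u x‖ₑ ^ (3 : ℝ)
      = ∫⁻ x, (‖u x‖ₑ ^ (2 : ℝ)) ^ (1 - b) * (‖u x‖ₑ ^ q) ^ b := by
        refine lintegral_congr fun x => ?_
        rw [← ENNReal.rpow_mul, ← ENNReal.rpow_mul,
          ← ENNReal.rpow_add_of_nonneg _ _ (by nlinarith) (by nlinarith)]
        congr 1
        linarith
    _ ≤ (∫⁻ x, ‖u x‖ₑ ^ (2 : ℝ)) ^ (1 - b) * (∫⁻ x, ‖u x‖ₑ ^ q) ^ b :=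
        ENNReal.lintegral_mul_norm_pow_le (by fun_prop) (by fun_prop) (by linarith) hb0 (by ring)
    _ ≤ (∫⁻ x, ‖u x‖ₑ ^ (2 : ℝ)) ^ (1 - b) * (_) ^ b :=
        mul_le_mul' le_rfl (ENNReal.rpow_le_rpow (h u hu hcu) hb0)
    _ = _ := by
        rw [ENNReal.mul_rpow_of_nonneg _ _ hb0, ENNReal.mul_rpow_of_nonneg _ _ hb0,
          ← ENNReal.rpow_mul, ← ENNReal.rpow_mul, mul_comm, mul_assoc,
          ← ENNReal.rpow_add_of_nonneg _ _ (by positivity) (by linarith)]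
        congr 2
        · congr 1
          linear_combination (d : ℝ) / 4 * hbq
        · linear_combination (1/2 - (d : ℝ) / 4) * hbq

lemma GNI_high (d : ℕ) (hd : 3 ≤ d) : GNI d (2 * d / (d - 2)) := by
  have hd' : (3 : ℝ) ≤ d := by exact_mod_cast hd
  have hd2 : (0 : ℝ) < d - 2 := by linarith
  set q : ℝ := 2 * d / (d - 2) with hq
  have hq0 : 0 < q := by positivity
  have h1 : (d : ℝ) * (q - 2) / 4 = q / 2 := by rw [hq]; field_simp; ring
  let q' : ℝ≥0 := ⟨q, hq0.le⟩
  set K := SNormLESNormFDerivOfEqConst ℂ (volume : Measure (EuclideanSpace ℝ (Fin d))) ((2 : ℝ≥0) : ℝ) with hK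
  refine ⟨(K : ℝ≥0∞) ^ q, ENNReal.rpow_ne_top_of_nonneg hq0.le ENNReal.coe_ne_top, fun u hu hcu => ?_⟩
  rw [h1]
  have h := eLpNorm_le_eLpNorm_fderiv_of_eq (volume : Measure (EuclideanSpace ℝ (Fin d)))
    hu hcu (p := 2) (p' := q') (by norm_num) (by simp; omega) (by
      simp only [finrank_euclideanSpace, Fintype.card_fin]
      change q⁻¹ = _
      rw [hq]; push_cast; field_simp)
  have hq'0 : q' ≠ 0 := by
    intro h0
    have : (q' : ℝ) = 0 := by rw [h0]; rfl
    exact hq0.ne' this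
  rw [eLpNorm_nnreal_eq_lintegral hq'0, eLpNorm_nnreal_eq_lintegral two_ne_zero] at h
  change (∫⁻ x, ‖u x‖ₑ ^ q) ^ (1 / q) ≤ K * (∫⁻ x, ‖fderiv ℝ u x‖ₑ ^ (2 : ℝ)) ^ (1 / (2 : ℝ)) at h
  have h3 := ENNReal.rpow_le_rpow h hq0.le
  rw [← ENNReal.rpow_mul, one_div_mul_cancel hq0.ne', ENNReal.rpow_one,
    ENNReal.mul_rpow_of_nonneg _ _ hq0.le, ← ENNReal.rpow_mul] at h3
  refine h3.trans_eq ?_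
  rw [sub_self, ENNReal.rpow_zero, mul_one]
  congr 2
  ring

lemma fderiv_pow_enorm_s1 {E : Type*} [NormedAddCommGroup E] [NormedSpace ℝ E] (u : E → ℂ)
    (hu : ContDiff ℝ 1 u) (n : ℕ) (x : E) :
    ‖fderiv ℝ (fun y => u y ^ (n + 1)) x‖ₑ ≤ (n + 1 : ℝ≥0∞) * (‖u x‖ₑ ^ n * ‖fderiv ℝ u x‖ₑ) := by
  have hd : HasFDerivAt u (fderiv ℝ u x) x := (hu.differentiable one_ne_zero x).hasFDerivAt
  rw [(hd.pow (n + 1)).fderiv, enorm_smul]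
  simp [enorm_mul, enorm_pow, mul_assoc]
  gcongr
  rw [← ofReal_norm]
  rw [show ‖((n : ℂ) + 1)‖ = ((n + 1 : ℕ) : ℝ) by
    rw [← Nat.cast_succ]; exact Complex.norm_natCast _]
  rw [ENNReal.ofReal_natCast]
  push_cast
  exact le_rfl

lemma lint_fderiv_pow {E : Type*} [NormedAddCommGroup E] [NormedSpace ℝ E]
    [MeasureSpace E] [BorelSpace E] (u : E → ℂ)
    (hu : ContDiff ℝ 1 u) (n : ℕ) :
    ∫⁻ x, ‖fderiv ℝ (fun y => u y ^ (n + 1)) x‖ₑ ≤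
      (n + 1 : ℝ≥0∞) * ((∫⁻ x, ‖u x‖ₑ ^ (2 * n : ℝ)) ^ (1 / 2 : ℝ) *
        (∫⁻ x, ‖fderiv ℝ u x‖ₑ ^ (2 : ℝ)) ^ (1 / 2 : ℝ)) := by
  have hc : Continuous (fderiv ℝ u) := hu.continuous_fderiv one_ne_zero
  have hc0 := hu.continuous
  have hm : Measurable (fun x => ‖fderiv ℝ u x‖ₑ) := hc.enorm.measurable
  have hm0 : Measurable (fun x => ‖u x‖ₑ) := hc0.enorm.measurable
  calc _ ≤ ∫⁻ x, (n + 1 : ℝ≥0∞) * (‖u x‖ₑ ^ n * ‖fderiv ℝ u x‖ₑ) :=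
        lintegral_mono (fderiv_pow_enorm_s1 u hu n)
    _ = (n + 1 : ℝ≥0∞) * ∫⁻ x, (‖u x‖ₑ ^ (2 * n : ℝ)) ^ (1 / 2 : ℝ) *
          (‖fderiv ℝ u x‖ₑ ^ (2 : ℝ)) ^ (1 / 2 : ℝ) := by
        rw [lintegral_const_mul' _ _ (by finiteness)]
        congr 1
        refine lintegral_congr fun x => ?_
        rw [← ENNReal.rpow_mul, ← ENNReal.rpow_mul]
        norm_num
        rw [show (2 * n * (1/2) : ℝ) = n by ring, ENNReal.rpow_natCast]
    _ ≤ _ := by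
        gcongr
        exact ENNReal.lintegral_mul_norm_pow_le (hm0.pow_const _).aemeasurable
          (hm.pow_const _).aemeasurable (by norm_num) (by norm_num) (by norm_num)

lemma GNI_two (n : ℕ) : GNI 2 (2 * ((n + 1 : ℕ) : ℝ)) := by
  induction n with
  | zero => exact ⟨1, by simp, fun u _ _ => by norm_num⟩
  | succ n ih =>
    obtain ⟨C, hC, h⟩ := ih
    set K := lintegralPowLePowLIntegralFDerivConst (volume : Measure (EuclideanSpace ℝ (Fin 2))) 2
    refine ⟨K * ((n + 1 : ℕ) + 1 : ℝ≥0∞) ^ (2 : ℝ) * C, by finiteness, fun u hu hcu => ?_⟩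
    have h1 := lintegral_pow_le_pow_lintegral_fderiv
      (volume : Measure (EuclideanSpace ℝ (Fin 2))) (u := fun y => u y ^ (n + 1 + 1)) (p := 2)
      (hu.pow _) (by
        refine hcu.comp_left (g := fun z : ℂ => z ^ (n + 1 + 1)) (by simp)) (by
        simp only [finrank_euclideanSpace, Fintype.card_fin]
        exact_mod_cast Real.HolderConjugate.two_two)
    have h2 := lint_fderiv_pow u hu (n + 1)
    have h3 := h u hu hcu
    set G := ∫⁻ x, ‖fderiv ℝ u x‖ₑ ^ (2 : ℝ)
    set M := ∫⁻ x, ‖u x‖ₑ ^ (2 : ℝ)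
    calc ∫⁻ x, ‖u x‖ₑ ^ (2 * ((n + 1 + 1 : ℕ) : ℝ))
        = ∫⁻ x, ‖u x ^ (n + 1 + 1)‖ₑ ^ (2 : ℝ) := by
          refine lintegral_congr fun x => ?_
          rw [enorm_pow, ← ENNReal.rpow_natCast, ← ENNReal.rpow_mul, mul_comm]
      _ ≤ _ := h1
      _ ≤ K * _ ^ (2 : ℝ) := mul_le_mul' le_rfl (ENNReal.rpow_le_rpow h2 (by norm_num))
      _ = K * ((n + 1 : ℕ) + 1 : ℝ≥0∞) ^ (2 : ℝ) *
          ((∫⁻ x, ‖u x‖ₑ ^ (2 * ((n + 1 : ℕ) : ℝ))) * G) := by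
          rw [ENNReal.mul_rpow_of_nonneg _ _ (by norm_num),
            ENNReal.mul_rpow_of_nonneg _ _ (by norm_num), ← ENNReal.rpow_mul, ← ENNReal.rpow_mul]
          norm_num [mul_assoc]
      _ ≤ K * ((n + 1 : ℕ) + 1 : ℝ≥0∞) ^ (2 : ℝ) * (_ * G) :=
          mul_le_mul' le_rfl (mul_le_mul' h3 le_rfl)
      _ = _ := by
          rw [show ((2 : ℕ) : ℝ) * (2 * ((n + 1 + 1 : ℕ) : ℝ) - 2) / 4 =
            ((2 : ℕ) : ℝ) * (2 * ((n + 1 : ℕ) : ℝ) - 2) / 4 + 1 by push_cast; ring,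
            ENNReal.rpow_add_of_nonneg _ _ (by push_cast; ring_nf; positivity) (by norm_num), ENNReal.rpow_one,
            show (2 * ((n + 1 + 1 : ℕ) : ℝ)) / 2 - (((2 : ℕ) : ℝ) * (2 * ((n + 1 : ℕ) : ℝ) - 2) / 4 + 1)
              = (2 * ((n + 1 : ℕ) : ℝ)) / 2 - (((2 : ℕ) : ℝ) * (2 * ((n + 1 : ℕ) : ℝ) - 2) / 4) by
              push_cast; ring]
          ring

lemma sup_one_s1 (v : EuclideanSpace ℝ (Fin 1) → ℂ) (hv : ContDiff ℝ 1 v) (hcv : HasCompactSupport v)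
    (x : EuclideanSpace ℝ (Fin 1)) : ‖v x‖ₑ ≤ ∫⁻ y, ‖fderiv ℝ v y‖ₑ := by
  let L := (OrthonormalBasis.singleton (Fin 1) ℝ).repr
  have hL : MeasurePreserving L := L.measurePreserving
  have hemb : Topology.IsClosedEmbedding L := L.toHomeomorph.isClosedEmbedding
  have h1 : ContDiff ℝ 1 (v ∘ L) := hv.comp L.contDiff
  have h2 : HasCompactSupport (v ∘ L) := hcv.comp_isClosedEmbedding hemb
  calc ‖v x‖ₑ = ‖(v ∘ L) (L.symm x)‖ₑ := by simp
    _ ≤ ∫⁻ y in Set.Iic (L.symm x), ‖deriv (v ∘ L) y‖ₑ :=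
        h2.enorm_le_lintegral_Ici_deriv h1 _
    _ ≤ ∫⁻ y, ‖deriv (v ∘ L) y‖ₑ := setLIntegral_le_lintegral _ _
    _ ≤ ∫⁻ y, ‖fderiv ℝ v (L y)‖ₑ := by
        refine lintegral_mono fun y => ?_
        have hd : HasFDerivAt v (fderiv ℝ v (L y)) (L y) :=
          (hv.differentiable one_ne_zero _).hasFDerivAt
        have hLd : HasDerivAt L (L 1) y := by
          have := (L.toContinuousLinearEquiv : ℝ →L[ℝ] EuclideanSpace ℝ (Fin 1)).hasDerivAt (x := y)
          exact this
        rw [(hd.comp_hasDerivAt y hLd).deriv]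
        refine (ContinuousLinearMap.le_opENorm _ _).trans ?_
        have : ‖L 1‖ₑ = 1 := by
          have hn : ‖L 1‖ = ‖(1 : ℝ)‖ := L.norm_map 1
          rw [← ofReal_norm, hn]; simp
        rw [this, mul_one]
    _ = ∫⁻ y, ‖fderiv ℝ v y‖ₑ :=
        hL.lintegral_comp (hv.continuous_fderiv one_ne_zero).enorm.measurable

lemma GNI_one (p : ℝ) (hp : 2 ≤ p) : GNI 1 p := by
  refine ⟨2 ^ ((p - 2) / 2), ENNReal.rpow_ne_top_of_nonneg (by linarith) (by simp), fun u hu hcu => ?_⟩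
  have h2 := lint_fderiv_pow u hu 1
  set G := ∫⁻ x, ‖fderiv ℝ u x‖ₑ ^ (2 : ℝ)
  set M := ∫⁻ x, ‖u x‖ₑ ^ (2 : ℝ) with hM
  have h3 : ∀ x, ‖u x‖ₑ ^ (2 : ℝ) ≤ 2 * (M ^ (1 / 2 : ℝ) * G ^ (1 / 2 : ℝ)) := by
    intro x
    have h1 := sup_one_s1 (fun y => u y ^ (1 + 1)) (hu.pow _)
      (hcu.comp_left (g := fun z : ℂ => z ^ (1 + 1)) (by simp)) x
    refine (le_of_eq ?_).trans (h1.trans (h2.trans_eq ?_))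
    · simp [enorm_pow]
    · norm_num [hM]
  have hp' : 0 ≤ (p - 2) / 2 := by linarith
  calc ∫⁻ x, ‖u x‖ₑ ^ p = ∫⁻ x, (‖u x‖ₑ ^ (2 : ℝ)) ^ ((p - 2) / 2) * ‖u x‖ₑ ^ (2 : ℝ) := by
        refine lintegral_congr fun x => ?_
        rw [← ENNReal.rpow_mul, ← ENNReal.rpow_add_of_nonneg _ _ (by linarith) (by norm_num)]
        congr 1; ring
    _ ≤ ∫⁻ x, (2 * (M ^ (1 / 2 : ℝ) * G ^ (1 / 2 : ℝ))) ^ ((p - 2) / 2) * ‖u x‖ₑ ^ (2 : ℝ) := by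
        gcongr with x
        exact h3 x
    _ = (2 * (M ^ (1 / 2 : ℝ) * G ^ (1 / 2 : ℝ))) ^ ((p - 2) / 2) * M := by
        rw [lintegral_const_mul _ (hu.continuous.enorm.measurable.pow_const _)]
    _ = _ := by
        rw [ENNReal.mul_rpow_of_nonneg _ _ hp', ENNReal.mul_rpow_of_nonneg _ _ hp',
          ← ENNReal.rpow_mul, ← ENNReal.rpow_mul,
          show p / 2 - ((1 : ℕ) : ℝ) * (p - 2) / 4 = 1 / 2 * ((p - 2) / 2) + 1 by push_cast; ring,
          ENNReal.rpow_add_of_nonneg _ _ (by linarith) (by norm_num), ENNReal.rpow_one,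
          show ((1 : ℕ) : ℝ) * (p - 2) / 4 = 1 / 2 * ((p - 2) / 2) by push_cast; ring]
        ring

lemma ball_int (d : ℕ) (hd : 1 ≤ d) (β : ℝ) (hβ : β < d) :
    ∃ c : ℝ≥0∞, c ≠ ⊤ ∧ ∀ R : ℝ, 0 < R →
      ∫⁻ x in Metric.ball (0 : EuclideanSpace ℝ (Fin d)) R, ENNReal.ofReal (‖x‖ ^ (-β)) ≤
        c * ENNReal.ofReal R ^ (d - β) := by
  have : Nonempty (Fin d) := ⟨⟨0, hd⟩⟩
  set V := (volume : Measure (EuclideanSpace ℝ (Fin d))).real (Metric.ball 0 1)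
  refine ⟨ENNReal.ofReal (d * (V * (1 / (d - β)))), ENNReal.ofReal_ne_top, fun R hR => ?_⟩
  have hdβ : 0 < d - β := by linarith
  have hpow : ∀ y ∈ Set.Ioo (0 : ℝ) R, y ^ (d - 1) * y ^ (-β) = y ^ (d - 1 - β : ℝ) := by
    intro y hy
    rw [← Real.rpow_natCast, ← Real.rpow_add hy.1]
    congr 1
    rw [Nat.cast_sub hd]; push_cast; ring
  have hi1 : IntegrableOn (fun y : ℝ => y ^ (d - 1 - β : ℝ)) (Set.Ioo 0 R) := by
    rw [← intervalIntegrable_iff_integrableOn_Ioo_of_le hR.le]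
    exact intervalIntegral.intervalIntegrable_rpow' (by linarith)
  have hi : IntegrableOn (fun x : EuclideanSpace ℝ (Fin d) => ‖x‖ ^ (-β)) (Metric.ball 0 R) := by
    rw [integrableOn_fun_norm_addHaar volume (f := fun y : ℝ => y ^ (-β))]
    simp only [finrank_euclideanSpace, Fintype.card_fin, smul_eq_mul]
    exact hi1.congr_fun (fun y hy => (hpow y hy).symm) measurableSet_Ioo
  rw [← ofReal_integral_eq_lintegral_ofReal hi (by
    filter_upwards with x; positivity)]
  rw [ENNReal.ofReal_rpow_of_pos hR, ← ENNReal.ofReal_mul (by positivity)]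
  apply le_of_eq
  congr 1
  rw [← integral_indicator measurableSet_ball]
  have h1 : ∀ x : EuclideanSpace ℝ (Fin d),
      (Metric.ball (0 : EuclideanSpace ℝ (Fin d)) R).indicator (fun x => ‖x‖ ^ (-β)) x =
      (Set.Iio R).indicator (fun y : ℝ => y ^ (-β)) ‖x‖ := by
    intro x
    simp [Set.indicator]
  simp_rw [h1]
  rw [integral_fun_norm_addHaar volume]
  simp only [finrank_euclideanSpace, Fintype.card_fin, smul_eq_mul, nsmul_eq_mul]
  have h2 : ∫ y in Set.Ioi (0 : ℝ), y ^ (d - 1) * (Set.Iio R).indicator (fun y : ℝ => y ^ (-β)) y =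
      R ^ (d - β) / (d - β) := by
    have : ∀ y : ℝ, y ^ (d - 1) * (Set.Iio R).indicator (fun y : ℝ => y ^ (-β)) y =
      (Set.Iio R).indicator (fun y : ℝ => y ^ (d - 1) * y ^ (-β)) y := by
      intro y; simp [Set.indicator]
    simp_rw [this]
    rw [setIntegral_indicator measurableSet_Iio, Set.Ioi_inter_Iio,
      setIntegral_congr_fun measurableSet_Ioo hpow, ← integral_Ioc_eq_integral_Ioo,
      ← intervalIntegral.integral_of_le hR.le, integral_rpow (Or.inl (by linarith))]
    rw [show (d : ℝ) - 1 - β + 1 = d - β by ring, Real.zero_rpow hdβ.ne', sub_zero]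
  rw [h2]
  change (d : ℝ) * (V * _) = _
  ring

lemma fin_lint {E F : Type*} [NormedAddCommGroup E] [NormedSpace ℝ E]
    [MeasureSpace E] [BorelSpace E] [IsLocallyFiniteMeasure (volume : Measure E)]
    [NormedAddCommGroup F] [SecondCountableTopologyEither E F] (v : E → F)
    (hv : Continuous v) (hcv : HasCompactSupport v) : ∫⁻ x, ‖v x‖ₑ ^ (2 : ℝ) ≠ ⊤ := by
  have h : MemLp v 2 volume := hv.memLp_of_hasCompactSupport hcv
  have := lintegral_rpow_enorm_lt_top_of_eLpNorm_lt_top (p := 2) (by simp) (by simp) h.2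
  simpa using this.ne

lemma weighted_s1 (d : ℕ) (hd1 : 1 ≤ d) (hd5 : d ≤ 5) (α a b : ℝ) (hα : 0 < α) (ha : 0 < a)
    (hb : 0 < b) (hab : a + b = 1) (haα : α / a < d) (hq : GNI d (3 / b)) (h3 : GNI d 3) :
    ∃ C : ℝ≥0∞, C ≠ ⊤ ∧ ∀ u : EuclideanSpace ℝ (Fin d) → ℂ, ContDiff ℝ 1 u → HasCompactSupport u →
    ∫⁻ x, ENNReal.ofReal (‖x‖ ^ (-α)) * ‖u x‖ₑ ^ (3 : ℝ) ≤
      C * (∫⁻ x, ‖fderiv ℝ u x‖ₑ ^ (2 : ℝ)) ^ (((d : ℝ) + 2 * α) / 4)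
      * (∫⁻ x, ‖u x‖ₑ ^ (2 : ℝ)) ^ ((6 - (d : ℝ) - 2 * α) / 4) := by
  obtain ⟨Cq, hCq, hq⟩ := hq
  obtain ⟨C3, hC3, h3⟩ := h3
  obtain ⟨c, hc, hball⟩ := ball_int d hd1 (α / a) haα
  refine ⟨c ^ a * Cq ^ b + C3, ?_, fun u hu hcu => ?_⟩
  · exact ENNReal.add_ne_top.2 ⟨ENNReal.mul_ne_top (ENNReal.rpow_ne_top_of_nonneg ha.le hc)
      (ENNReal.rpow_ne_top_of_nonneg hb.le hCq), hC3⟩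
  have hd1' : (1 : ℝ) ≤ d := by exact_mod_cast hd1
  have hd5' : (d : ℝ) ≤ 5 := by exact_mod_cast hd5
  have hmu : Measurable (fun x => ‖u x‖ₑ) := hu.continuous.enorm.measurable
  have hGt := fin_lint _ (hu.continuous_fderiv one_ne_zero) (hcu.fderiv ℝ)
  have hMt := fin_lint _ hu.continuous hcu
  replace hq := hq u hu hcu
  replace h3 := h3 u hu hcu
  set G := ∫⁻ x, ‖fderiv ℝ u x‖ₑ ^ (2 : ℝ)
  set M := ∫⁻ x, ‖u x‖ₑ ^ (2 : ℝ)
  by_cases hGM : G = 0 ∨ M = 0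
  · have h30 : ∫⁻ x, ‖u x‖ₑ ^ (3 : ℝ) = 0 := by
      refine le_antisymm (h3.trans_eq ?_) bot_le
      rcases hGM with h | h
      · rw [h, ENNReal.zero_rpow_of_pos (by linarith)]; simp
      · rw [h, ENNReal.zero_rpow_of_pos (by linarith)]; simp
    rw [lintegral_eq_zero_iff (hmu.pow_const _)] at h30
    have : ∫⁻ x, ENNReal.ofReal (‖x‖ ^ (-α)) * ‖u x‖ₑ ^ (3 : ℝ) = 0 := by
      rw [lintegral_eq_zero_iff' (by fun_prop)]
      filter_upwards [h30] with x hx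
      simp only [Pi.zero_apply] at hx ⊢
      rw [hx, mul_zero]
    rw [this]; exact bot_le
  push Not at hGM
  obtain ⟨hG0, hM0⟩ := hGM
  set R : ℝ≥0∞ := M ^ (1 / 2 : ℝ) * G ^ (-(1 / 2) : ℝ) with hR
  have hRt : R ≠ ⊤ := ENNReal.mul_ne_top (ENNReal.rpow_ne_top_of_ne_zero hM0 hMt)
    (ENNReal.rpow_ne_top_of_ne_zero hG0 hGt)
  have hR0 : R ≠ 0 := mul_ne_zero (ENNReal.rpow_pos (pos_iff_ne_zero.2 hM0) hMt).ne'
    (ENNReal.rpow_pos (pos_iff_ne_zero.2 hG0) hGt).ne'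
  have hRp : ∀ y : ℝ, R ^ y = M ^ (y / 2) * G ^ (-(y / 2)) := by
    intro y
    rw [hR, ENNReal.mul_rpow_of_ne_top (ENNReal.rpow_ne_top_of_ne_zero hM0 hMt)
    (ENNReal.rpow_ne_top_of_ne_zero hG0 hGt), ← ENNReal.rpow_mul, ← ENNReal.rpow_mul]
    congr 2 <;> ring
  have hr : 0 < R.toReal := ENNReal.toReal_pos hR0 hRt
  have hRr : ENNReal.ofReal R.toReal = R := ENNReal.ofReal_toReal hRt
  set B := Metric.ball (0 : EuclideanSpace ℝ (Fin d)) R.toReal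
  have hin : ∫⁻ x in B, ENNReal.ofReal (‖x‖ ^ (-α)) * ‖u x‖ₑ ^ (3 : ℝ) ≤
      c ^ a * Cq ^ b * G ^ (((d : ℝ) + 2 * α) / 4) * M ^ ((6 - (d : ℝ) - 2 * α) / 4) := by
    calc _ = ∫⁻ x in B, (ENNReal.ofReal (‖x‖ ^ (-(α / a)))) ^ a * (‖u x‖ₑ ^ (3 / b)) ^ b := by
          refine lintegral_congr fun x => ?_
          rw [ENNReal.ofReal_rpow_of_nonneg (by positivity) ha.le, ← Real.rpow_mul (by positivity),
            ← ENNReal.rpow_mul]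
          congr 2
          · congr 2; field_simp
          · field_simp
      _ ≤ (∫⁻ x in B, ENNReal.ofReal (‖x‖ ^ (-(α / a)))) ^ a * (∫⁻ x in B, ‖u x‖ₑ ^ (3 / b)) ^ b :=
          ENNReal.lintegral_mul_norm_pow_le (by fun_prop) (hmu.pow_const _).aemeasurable
            ha.le hb.le hab
      _ ≤ (c * R ^ (d - α / a)) ^ a * _ ^ b := by
          refine mul_le_mul' (ENNReal.rpow_le_rpow ?_ ha.le) (ENNReal.rpow_le_rpow
            ((setLIntegral_le_lintegral _ _).trans hq) hb.le)
          rw [← hRr]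
          exact hball _ hr
      _ = _ := by
          rw [ENNReal.mul_rpow_of_nonneg _ _ ha.le, ENNReal.mul_rpow_of_nonneg _ _ hb.le,
            ENNReal.mul_rpow_of_nonneg _ _ hb.le, ← ENNReal.rpow_mul, ← ENNReal.rpow_mul,
            ← ENNReal.rpow_mul, hRp]
          rw [show ∀ x1 x2 x3 x4 x5 x6 : ℝ≥0∞, x1 * (x2 * x3) * (x4 * x5 * x6) =
            x1 * x4 * (x3 * x5) * (x2 * x6) by intros; ring, ← ENNReal.rpow_add _ _ hG0 hGt,
            ← ENNReal.rpow_add _ _ hM0 hMt]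
          have hb' : b = 1 - a := by linarith
          congr 2
          · congr 1
            field_simp
            rw [hb']; ring
          · field_simp
            rw [hb']; ring
  have hout : ∫⁻ x in Bᶜ, ENNReal.ofReal (‖x‖ ^ (-α)) * ‖u x‖ₑ ^ (3 : ℝ) ≤
      C3 * G ^ (((d : ℝ) + 2 * α) / 4) * M ^ ((6 - (d : ℝ) - 2 * α) / 4) := by
    calc _ ≤ ∫⁻ x in Bᶜ, R ^ (-α) * ‖u x‖ₑ ^ (3 : ℝ) := by
          refine setLIntegral_mono' measurableSet_ball.compl fun x hx => ?_
          have hx' : R.toReal ≤ ‖x‖ := by simpa [B] using hx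
          refine mul_le_mul' ?_ le_rfl
          rw [← hRr, ENNReal.ofReal_rpow_of_pos hr]
          exact ENNReal.ofReal_le_ofReal (Real.rpow_le_rpow_of_nonpos hr hx' (by linarith))
      _ ≤ ∫⁻ x, R ^ (-α) * ‖u x‖ₑ ^ (3 : ℝ) := setLIntegral_le_lintegral _ _
      _ = R ^ (-α) * ∫⁻ x, ‖u x‖ₑ ^ (3 : ℝ) := lintegral_const_mul _ (hmu.pow_const _)
      _ ≤ R ^ (-α) * _ := mul_le_mul' le_rfl h3
      _ = _ := by
          rw [hRp, show ∀ x2 x3 x4 x5 x6 : ℝ≥0∞, (x2 * x3) * (x4 * x5 * x6) =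
            x4 * (x3 * x5) * (x2 * x6) by intros; ring, ← ENNReal.rpow_add _ _ hG0 hGt,
            ← ENNReal.rpow_add _ _ hM0 hMt]
          congr 2
          · congr 1; ring
          · ring
  rw [← lintegral_add_compl _ (measurableSet_ball : MeasurableSet B)]
  refine (add_le_add hin hout).trans_eq ?_
  ring

lemma weighted_all (d : ℕ) (hd1 : 1 ≤ d) (hd5 : d ≤ 5) (α : ℝ)
    (hα0 : 0 < α) (hα1 : α < min 2 (d : ℝ))
    (hα2 : 3 ≤ d → α < (6 - (d : ℝ)) / 2) :
    ∃ C : ℝ≥0∞, C ≠ ⊤ ∧ ∀ u : EuclideanSpace ℝ (Fin d) → ℂ, ContDiff ℝ 1 u → HasCompactSupport u →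
    ∫⁻ x, ENNReal.ofReal (‖x‖ ^ (-α)) * ‖u x‖ₑ ^ (3 : ℝ) ≤
      C * (∫⁻ x, ‖fderiv ℝ u x‖ₑ ^ (2 : ℝ)) ^ (((d : ℝ) + 2 * α) / 4)
      * (∫⁻ x, ‖u x‖ₑ ^ (2 : ℝ)) ^ ((6 - (d : ℝ) - 2 * α) / 4) := by
  have hd1' : (1 : ℝ) ≤ d := by exact_mod_cast hd1
  have hd5' : (d : ℝ) ≤ 5 := by exact_mod_cast hd5
  have hαd : α < d := hα1.trans_le (min_le_right _ _)
  rcases le_or_gt 3 d with h3 | h3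
  · have h3' : (3 : ℝ) ≤ d := by exact_mod_cast h3
    have hα := hα2 h3
    have hd2 : (0 : ℝ) < d - 2 := by linarith
    have hq : (3 : ℝ) < 2 * d / (d - 2) := by
      rw [lt_div_iff₀ hd2]; linarith
    have hG := GNI_high d h3
    have ha : (0 : ℝ) < (6 - d) / (2 * d) := div_pos (by linarith) (by linarith)
    refine weighted_s1 d hd1 hd5 α ((6 - d) / (2 * d)) (3 * (d - 2) / (2 * d)) hα0 ha
      (by positivity) (by field_simp; ring) ?_ ?_ ?_
    · rw [div_lt_iff₀ ha]
      refine hα.trans_eq ?_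
      field_simp
    · convert hG using 1
      field_simp
    · refine GNI_interp d _ hq hG (le_of_eq ?_)
      field_simp; ring
  · have hpos : 0 < 1 - α / d := by
      rw [sub_pos, div_lt_one (by linarith)]; exact hαd
    obtain ⟨n, hn⟩ := exists_nat_gt (3 / (2 * (1 - α / d)))
    have hn1 : 3 / (2 * (1 - α / d)) < (n : ℝ) + 1 := by linarith
    have hn0 : (0 : ℝ) < (n : ℝ) + 1 := by positivity
    set b : ℝ := 3 / (2 * ((n : ℝ) + 1)) with hb
    have hb0 : 0 < b := by positivity
    have hb1 : b < 1 - α / d := by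
      rw [div_lt_iff₀ (by positivity)] at hn1
      rw [hb, div_lt_iff₀ (by positivity)]
      linarith
    have hαd0 : 0 < α / d := by positivity
    have ha : 0 < 1 - b := by linarith
    have h3b : 3 / b = 2 * (((n + 1 : ℕ)) : ℝ) := by
      rw [hb]; push_cast; field_simp
    have hq3 : (3 : ℝ) < 3 / b := by
      rw [lt_div_iff₀ hb0]; linarith
    have hG : GNI d (3 / b) := by
      interval_cases d
      · exact GNI_one _ (by linarith)
      · rw [h3b]; exact GNI_two n
    refine weighted_s1 d hd1 hd5 α (1 - b) b hα0 ha hb0 (by ring) ?_ hG ?_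
    · rw [div_lt_iff₀ ha]
      have : α / d < 1 - b := by linarith
      rwa [div_lt_iff₀ (by linarith), mul_comm] at this
    · refine GNI_interp d _ hq3 hG ?_
      interval_cases d
      · push_cast; linarith
      · push_cast; linarith

lemma cutoff (d : ℕ) : ∃ (K : ℝ) (χ : ℕ → EuclideanSpace ℝ (Fin d) → ℝ), 0 ≤ K ∧
    (∀ n, ContDiff ℝ 1 (χ n)) ∧ (∀ n, HasCompactSupport (χ n)) ∧ (∀ n x, |χ n x| ≤ 1) ∧
    (∀ n x, ‖fderiv ℝ (χ n) x‖ ≤ K / ((n : ℝ) + 1)) ∧ (∀ x, ∀ᶠ n in Filter.atTop, χ n x = 1) := by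
  let φ : ContDiffBump (0 : EuclideanSpace ℝ (Fin d)) := ⟨1, 2, one_pos, one_lt_two⟩
  have hφ : ContDiff ℝ 1 φ := φ.contDiff
  have hφc : HasCompactSupport φ := φ.hasCompactSupport
  obtain ⟨K, hK⟩ := (hφc.fderiv ℝ).exists_bound_of_continuous (hφ.continuous_fderiv one_ne_zero)
  have hK0 : 0 ≤ K := (norm_nonneg _).trans (hK 0)
  have hc : ∀ n : ℕ, ((n : ℝ) + 1)⁻¹ ≠ 0 := fun n => by positivity
  refine ⟨K, fun n x => φ (((n : ℝ) + 1)⁻¹ • x), hK0, fun n => ?_, fun n => ?_, fun n x => ?_,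
    fun n x => ?_, fun x => ?_⟩
  · exact hφ.comp (contDiff_const_smul _)
  · exact hφc.comp_smul (hc n)
  · rw [abs_of_nonneg φ.nonneg]; exact φ.le_one
  · have := fderiv_comp_smul (𝕜 := ℝ) (f := φ) (c := ((n : ℝ) + 1)⁻¹) (x := x)
    rw [this, norm_smul, Real.norm_of_nonneg (by positivity), div_eq_inv_mul]
    gcongr
    exact hK _
  · filter_upwards [Filter.eventually_ge_atTop ⌈‖x‖⌉₊] with n hn
    apply φ.one_of_mem_closedBall
    have h1 : ‖x‖ ≤ n := (Nat.le_ceil _).trans (by exact_mod_cast hn)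
    simp only [mem_closedBall_zero_iff, norm_smul]
    rw [Real.norm_of_nonneg (by positivity), inv_mul_le_iff₀ (by positivity)]
    change ‖x‖ ≤ ((n : ℝ) + 1) * 1
    linarith

lemma extend (d : ℕ) (α e1 e2 : ℝ) (he1 : 0 ≤ e1) (he2 : 0 ≤ e2) (C : ℝ≥0∞) (hC : C ≠ ⊤)
    (h : ∀ u : EuclideanSpace ℝ (Fin d) → ℂ, ContDiff ℝ 1 u → HasCompactSupport u →
      ∫⁻ x, ENNReal.ofReal (‖x‖ ^ (-α)) * ‖u x‖ₑ ^ (3 : ℝ) ≤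
      C * (∫⁻ x, ‖fderiv ℝ u x‖ₑ ^ (2 : ℝ)) ^ e1 * (∫⁻ x, ‖u x‖ₑ ^ (2 : ℝ)) ^ e2)
    (f : EuclideanSpace ℝ (Fin d) → ℂ) (hf : ContDiff ℝ 1 f)
    (hM : ∫⁻ x, ‖f x‖ₑ ^ (2 : ℝ) ≠ ⊤) :
      ∫⁻ x, ENNReal.ofReal (‖x‖ ^ (-α)) * ‖f x‖ₑ ^ (3 : ℝ) ≤
      C * (∫⁻ x, ‖fderiv ℝ f x‖ₑ ^ (2 : ℝ)) ^ e1 * (∫⁻ x, ‖f x‖ₑ ^ (2 : ℝ)) ^ e2 := by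
  obtain ⟨K, χ, hK, hχ1, hχ2, hχ3, hχ4, hχ5⟩ := cutoff d
  set G := ∫⁻ x, ‖fderiv ℝ f x‖ₑ ^ (2 : ℝ) with hG
  set M := ∫⁻ x, ‖f x‖ₑ ^ (2 : ℝ) with hMdef
  let u : ℕ → EuclideanSpace ℝ (Fin d) → ℂ := fun n x => χ n x • f x
  have hu1 : ∀ n, ContDiff ℝ 1 (u n) := fun n => (hχ1 n).smul hf
  have hu2 : ∀ n, HasCompactSupport (u n) := fun n => (hχ2 n).smul_right
  let ε : ℕ → ℝ≥0∞ := fun n => ENNReal.ofReal (K / ((n : ℝ) + 1))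
  have hχe : ∀ n x, ‖χ n x‖ₑ ≤ 1 := by
    intro n x
    rw [← ofReal_norm, ← ENNReal.ofReal_one]
    exact ENNReal.ofReal_le_ofReal (hχ3 n x)
  have hule : ∀ n x, ‖u n x‖ₑ ≤ ‖f x‖ₑ := by
    intro n x
    simp only [u, enorm_smul]
    exact mul_le_of_le_one_left' (hχe n x)
  have hMn : ∀ n, ∫⁻ x, ‖u n x‖ₑ ^ (2 : ℝ) ≤ M := fun n =>
    lintegral_mono fun x => ENNReal.rpow_le_rpow (hule n x) (by norm_num)
  have hdu : ∀ n x, ‖fderiv ℝ (u n) x‖ₑ ≤ ‖fderiv ℝ f x‖ₑ + ε n * ‖f x‖ₑ := by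
    intro n x
    have h1 : HasFDerivAt (χ n) (fderiv ℝ (χ n) x) x :=
      ((hχ1 n).differentiable one_ne_zero x).hasFDerivAt
    have h2 : HasFDerivAt f (fderiv ℝ f x) x := (hf.differentiable one_ne_zero x).hasFDerivAt
    have h3 := (h1.smul h2).fderiv
    change fderiv ℝ (u n) x = _ at h3
    rw [h3]
    refine (enorm_add_le (E := EuclideanSpace ℝ (Fin d) →L[ℝ] ℂ) _ _).trans (add_le_add ?_ ?_)
    · rw [enorm_smul]
      exact mul_le_of_le_one_left' (hχe n x)
    · rw [← ofReal_norm, ContinuousLinearMap.norm_smulRight_apply,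
        ENNReal.ofReal_mul (norm_nonneg _), ofReal_norm (f x)]
      gcongr
      exact ENNReal.ofReal_le_ofReal (hχ4 n x)
  have hGn : ∀ n, (∫⁻ x, ‖fderiv ℝ (u n) x‖ₑ ^ (2 : ℝ)) ^ (1 / 2 : ℝ) ≤
      G ^ (1 / 2 : ℝ) + ε n * M ^ (1 / 2 : ℝ) := by
    intro n
    have hmd : Measurable (fun x => ‖fderiv ℝ f x‖ₑ) :=
      (hf.continuous_fderiv one_ne_zero).enorm.measurable
    have hmf : Measurable (fun x => ‖f x‖ₑ) := hf.continuous.enorm.measurable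
    calc _ ≤ (∫⁻ x, (‖fderiv ℝ f x‖ₑ + ε n * ‖f x‖ₑ) ^ (2 : ℝ)) ^ (1 / 2 : ℝ) := by
          gcongr with x
          exact hdu n x
      _ ≤ (∫⁻ x, ‖fderiv ℝ f x‖ₑ ^ (2 : ℝ)) ^ (1 / 2 : ℝ) +
          (∫⁻ x, (ε n * ‖f x‖ₑ) ^ (2 : ℝ)) ^ (1 / 2 : ℝ) :=
          ENNReal.lintegral_Lp_add_le hmd.aemeasurable (hmf.const_mul _).aemeasurable (by norm_num)
      _ = _ := by
          congr 1
          simp_rw [ENNReal.mul_rpow_of_nonneg _ _ (by norm_num : (0 : ℝ) ≤ 2)]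
          rw [lintegral_const_mul _ (hmf.pow_const _), ENNReal.mul_rpow_of_nonneg _ _ (by norm_num),
            ← ENNReal.rpow_mul, show (2 : ℝ) * (1 / 2) = 1 by norm_num, ENNReal.rpow_one]
  have hbound : ∀ n, ∫⁻ x, ENNReal.ofReal (‖x‖ ^ (-α)) * ‖u n x‖ₑ ^ (3 : ℝ) ≤
      C * (G ^ (1 / 2 : ℝ) + ε n * M ^ (1 / 2 : ℝ)) ^ (2 * e1) * M ^ e2 := by
    intro n
    refine (h (u n) (hu1 n) (hu2 n)).trans ?_
    refine mul_le_mul' (mul_le_mul' le_rfl ?_) (ENNReal.rpow_le_rpow (hMn n) he2)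
    refine le_trans (le_of_eq ?_) (ENNReal.rpow_le_rpow (hGn n) (by linarith : 0 ≤ 2 * e1))
    rw [← ENNReal.rpow_mul]
    congr 1; ring
  have hMh : M ^ (1 / 2 : ℝ) ≠ ⊤ := ENNReal.rpow_ne_top_of_nonneg (by norm_num) hM
  have hε : Filter.Tendsto ε Filter.atTop (nhds 0) := by
    have : Filter.Tendsto (fun n : ℕ => K / ((n : ℝ) + 1)) Filter.atTop (nhds 0) := by
      have := tendsto_one_div_add_atTop_nhds_zero_nat (𝕜 := ℝ) |>.const_mul K
      simpa [div_eq_mul_inv] using this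
    simpa using ENNReal.tendsto_ofReal this
  have hlim : Filter.Tendsto
      (fun n => C * (G ^ (1 / 2 : ℝ) + ε n * M ^ (1 / 2 : ℝ)) ^ (2 * e1) * M ^ e2)
      Filter.atTop (nhds (C * G ^ e1 * M ^ e2)) := by
    have h1 : Filter.Tendsto (fun n => G ^ (1 / 2 : ℝ) + ε n * M ^ (1 / 2 : ℝ)) Filter.atTop
        (nhds (G ^ (1 / 2 : ℝ))) := by
      have := (ENNReal.Tendsto.mul_const hε (Or.inr hMh)).const_add (G ^ (1 / 2 : ℝ))
      simpa using this
    have h2 := (ENNReal.continuous_rpow_const (y := 2 * e1)).tendsto (G ^ (1 / 2 : ℝ)) |>.comp h1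
    rw [← ENNReal.rpow_mul, show (1 / 2 : ℝ) * (2 * e1) = e1 by ring] at h2
    exact ENNReal.Tendsto.mul_const (ENNReal.Tendsto.const_mul h2 (Or.inr hC))
      (Or.inr (ENNReal.rpow_ne_top_of_nonneg he2 hM))
  calc ∫⁻ x, ENNReal.ofReal (‖x‖ ^ (-α)) * ‖f x‖ₑ ^ (3 : ℝ)
      = ∫⁻ x, Filter.liminf
          (fun n => ENNReal.ofReal (‖x‖ ^ (-α)) * ‖u n x‖ₑ ^ (3 : ℝ)) Filter.atTop := by
        refine lintegral_congr fun x => ?_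
        symm
        apply Filter.Tendsto.liminf_eq
        apply tendsto_const_nhds.congr'
        filter_upwards [hχ5 x] with n hn
        simp [u, hn]
    _ ≤ Filter.liminf
          (fun n => ∫⁻ x, ENNReal.ofReal (‖x‖ ^ (-α)) * ‖u n x‖ₑ ^ (3 : ℝ)) Filter.atTop := by
        apply lintegral_liminf_le
        intro n
        have := (hu1 n).continuous.measurable
        fun_prop
    _ ≤ Filter.liminf (fun n => C * (G ^ (1 / 2 : ℝ) + ε n * M ^ (1 / 2 : ℝ)) ^ (2 * e1) * M ^ e2)
          Filter.atTop := Filter.liminf_le_liminf (Filter.Eventually.of_forall hbound)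
    _ = _ := hlim.liminf_eq

lemma lint_sq {E F : Type*} [NormedAddCommGroup E] [NormedSpace ℝ E]
    [MeasureSpace E] [BorelSpace E] [NormedAddCommGroup F] (v : E → F) (h : MemLp v 2 volume) :
    ∫⁻ x, ‖v x‖ₑ ^ (2 : ℝ) = ENNReal.ofReal (∫ x, ‖v x‖ ^ 2) := by
  have hi : Integrable (fun x => ‖v x‖ ^ 2) := h.integrable_norm_pow (by norm_num)
  rw [ofReal_integral_eq_lintegral_ofReal hi (by filter_upwards with x; positivity)]
  refine lintegral_congr fun x => ?_
  rw [ENNReal.ofReal_pow (norm_nonneg _), ofReal_norm]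
  norm_num

/-- Scalar weighted Gagliardo–Nirenberg inequality (Proposition 3.2, inequality part). -/
theorem scalar_weighted_gagliardo_nirenberg
    (d : ℕ) (hd1 : 1 ≤ d) (hd5 : d ≤ 5) (α : ℝ)
    (hα0 : 0 < α) (hα1 : α < min 2 (d : ℝ))
    (hα2 : 3 ≤ d → α < (6 - (d : ℝ)) / 2) :
    ∃ C > 0, ∀ f : SchwartzMap (EuclideanSpace ℝ (Fin d)) ℂ,
      (∫ x, ‖x‖ ^ (-α) * ‖f x‖ ^ 3) ≤
        C * ((∫ x, ‖fderiv ℝ (⇑f) x‖ ^ 2) ^ ((1 : ℝ) / 2)) ^ (((d : ℝ) + 2 * α) / 2)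
          * ((∫ x, ‖f x‖ ^ 2) ^ ((1 : ℝ) / 2)) ^ ((6 - (d : ℝ) - 2 * α) / 2) := by
  obtain ⟨C, hC, hw⟩ := weighted_all d hd1 hd5 α hα0 hα1 hα2
  have he1 : 0 ≤ ((d : ℝ) + 2 * α) / 4 := by positivity
  have he2 : 0 ≤ (6 - (d : ℝ) - 2 * α) / 4 := by
    rcases le_or_gt 3 d with h | h
    · have := hα2 h; linarith
    · have h1 := hα1.trans_le (min_le_left _ _)
      have h2 := hα1.trans_le (min_le_right _ _)
      have : (d : ℝ) ≤ 2 := by exact_mod_cast (by omega : d ≤ 2)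
      linarith
  refine ⟨C.toReal + 1, by positivity, fun f => ?_⟩
  have hf1 : ContDiff ℝ 1 f := f.smooth 1
  have hmf : MemLp f 2 volume := f.memLp 2
  have hmd : MemLp (fderiv ℝ f) 2 volume := by
    have hm := (SchwartzMap.fderivCLM ℝ _ _ f).memLp 2 volume
    have hfe : ⇑(SchwartzMap.fderivCLM ℝ _ _ f) = fderiv ℝ f := by
      ext1 x
      exact SchwartzMap.fderivCLM_apply ..
    rwa [hfe] at hm
  have h1 := lint_sq _ hmf
  have h2 := lint_sq _ hmd
  have h := extend d α _ _ he1 he2 C hC hw f hf1 (by rw [h1]; exact ENNReal.ofReal_ne_top)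
  rw [h1, h2] at h
  have hG0 : 0 ≤ ∫ x, ‖fderiv ℝ (⇑f) x‖ ^ 2 := integral_nonneg fun x => by positivity
  have hM0 : 0 ≤ ∫ x, ‖f x‖ ^ 2 := integral_nonneg fun x => by positivity
  set G := ∫ x, ‖fderiv ℝ (⇑f) x‖ ^ 2
  set M := ∫ x, ‖f x‖ ^ 2
  rw [ENNReal.ofReal_rpow_of_nonneg hG0 he1, ENNReal.ofReal_rpow_of_nonneg hM0 he2,
    ← ENNReal.ofReal_toReal hC, ← ENNReal.ofReal_mul (by positivity),
    ← ENNReal.ofReal_mul (by positivity)] at h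
  rw [← Real.rpow_mul hG0, ← Real.rpow_mul hM0,
    show (1 : ℝ) / 2 * (((d : ℝ) + 2 * α) / 2) = ((d : ℝ) + 2 * α) / 4 by ring,
    show (1 : ℝ) / 2 * ((6 - (d : ℝ) - 2 * α) / 2) = (6 - (d : ℝ) - 2 * α) / 4 by ring]
  rw [integral_eq_lintegral_of_nonneg_ae (by filter_upwards with x; positivity) (by
    have := hf1.continuous.measurable
    exact Measurable.aestronglyMeasurable (by fun_prop))]
  refine ENNReal.toReal_le_of_le_ofReal (by positivity) ?_
  refine le_trans (le_of_eq ?_) (h.trans (ENNReal.ofReal_le_ofReal ?_))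
  · refine lintegral_congr fun x => ?_
    rw [ENNReal.ofReal_mul (by positivity), ENNReal.ofReal_pow (norm_nonneg _), ofReal_norm]
    norm_num
  · gcongr
    linarith

end
end

section
/- Weighted scaling (dilation) identity used in the Pohozaev argument: Let d ≥ 1 be an integer and let α be a real number with 0 < α < d. Then for all Schwartz functions φ, ψ : ℝ^d → ℂ one has 2 Re ∫_{ℝ^d} |x|^{−α} conj(φ(x)) ψ(x) (x · ∇conj(φ)(x)) dx + Re ∫_{ℝ^d} |x|^{−α} φ(x)² (x · ∇conj(ψ)(x)) dx = −(d−α) Re ∫_{ℝ^d} |x|^{−α} φ(x)² conj(ψ(x)) dx. -/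
open MeasureTheory SchwartzMap

noncomputable section

lemma wsi_weight_integrable (d : ℕ) (hd : 1 ≤ d) (α : ℝ) (hα0 : 0 < α) (hαd : α < (d : ℝ)) :
    Integrable (fun x : EuclideanSpace ℝ (Fin d) => ‖x‖ ^ (-α) * ((1 + ‖x‖) ^ (d + 1))⁻¹) := by
  haveI : Nonempty (Fin d) := ⟨⟨0, hd⟩⟩
  haveI : Nontrivial (EuclideanSpace ℝ (Fin d)) := inferInstance
  refine (integrable_fun_norm_addHaar (volume : Measure (EuclideanSpace ℝ (Fin d)))
    (f := fun r : ℝ => r ^ (-α) * ((1 + r) ^ (d + 1))⁻¹)).2 ?_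
  rw [finrank_euclideanSpace_fin]
  have hmeas : Measurable (fun y : ℝ => y ^ (d - 1) • (y ^ (-α) * ((1 + y) ^ (d + 1))⁻¹)) := by
    simp only [smul_eq_mul]
    fun_prop
  have hpow : ∀ y : ℝ, 0 < y → y ^ (d - 1) * y ^ (-α) = y ^ ((d : ℝ) - 1 - α) := by
    intro y hy
    rw [← Real.rpow_natCast, ← Real.rpow_add hy]
    congr 1
    push_cast [Nat.cast_sub hd]
    ring
  rw [← Set.Ioc_union_Ioi_eq_Ioi (zero_le_one' ℝ)]
  refine IntegrableOn.union ?_ ?_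
  · have h1 : IntegrableOn (fun y : ℝ => y ^ ((d : ℝ) - 1 - α)) (Set.Ioc 0 1) := by
      have := intervalIntegral.intervalIntegrable_rpow' (a := 0) (b := 1)
        (r := (d : ℝ) - 1 - α) (by linarith)
      rwa [intervalIntegrable_iff_integrableOn_Ioc_of_le zero_le_one] at this
    refine Integrable.mono' h1 hmeas.aestronglyMeasurable ?_
    refine (ae_restrict_iff' measurableSet_Ioc).2 (Filter.Eventually.of_forall ?_)
    rintro y ⟨hy0, hy1⟩
    rw [smul_eq_mul, ← mul_assoc, hpow y hy0, Real.norm_of_nonneg (by positivity)]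
    refine mul_le_of_le_one_right (by positivity) ?_
    exact inv_le_one_of_one_le₀ (one_le_pow₀ (by linarith))
  · have h1 : IntegrableOn (fun y : ℝ => y ^ (-2 - α)) (Set.Ioi 1) :=
      integrableOn_Ioi_rpow_of_lt (by linarith) one_pos
    refine Integrable.mono' h1 hmeas.aestronglyMeasurable ?_
    refine (ae_restrict_iff' measurableSet_Ioi).2 (Filter.Eventually.of_forall ?_)
    intro y hy
    have hy0 : (0 : ℝ) < y := lt_trans one_pos hy
    rw [smul_eq_mul, ← mul_assoc, hpow y hy0, Real.norm_of_nonneg (by positivity)]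
    have h2 : y ^ (-2 - α) = y ^ ((d : ℝ) - 1 - α) * (y ^ (d + 1))⁻¹ := by
      rw [← Real.rpow_natCast, ← Real.rpow_neg hy0.le, ← Real.rpow_add hy0]
      congr 1
      push_cast
      ring
    rw [h2]
    gcongr
    linarith

lemma wsi_integrable (d : ℕ) (hd : 1 ≤ d) (α : ℝ) (hα0 : 0 < α) (hαd : α < (d : ℝ))
    (H : EuclideanSpace ℝ (Fin d) → ℂ) (hH : Continuous H) (C : ℝ)
    (hC : ∀ x, (1 + ‖x‖) ^ (d + 1) * ‖H x‖ ≤ C) :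
    Integrable (fun x => Complex.ofReal (‖x‖ ^ (-α)) * H x) := by
  refine Integrable.mono' ((wsi_weight_integrable d hd α hα0 hαd).mul_const C) ?_ ?_
  · refine (Measurable.mul ?_ hH.measurable).aestronglyMeasurable
    fun_prop
  · refine Filter.Eventually.of_forall fun x => ?_
    rw [norm_mul, Complex.norm_real, Real.norm_of_nonneg (by positivity), mul_assoc]
    gcongr
    rw [le_inv_mul_iff₀ (by positivity)]
    exact hC x

lemma wsi_decay0 {d : ℕ} (G : SchwartzMap (EuclideanSpace ℝ (Fin d)) ℂ) (k : ℕ) :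
    ∃ C, 0 ≤ C ∧ ∀ x, (1 + ‖x‖) ^ k * ‖G x‖ ≤ C := by
  have h := fun x => one_add_le_sup_seminorm_apply (𝕜 := ℝ) (m := (k, 0)) (le_refl k)
    (le_refl 0) G x
  simp only [norm_iteratedFDeriv_zero] at h
  exact ⟨_, le_trans (by positivity) (h 0), h⟩

lemma wsi_decay1 {d : ℕ} (G : SchwartzMap (EuclideanSpace ℝ (Fin d)) ℂ) (k : ℕ) :
    ∃ C, 0 ≤ C ∧ ∀ x, (1 + ‖x‖) ^ k * ‖fderiv ℝ G x‖ ≤ C := by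
  have h := fun x => one_add_le_sup_seminorm_apply (𝕜 := ℝ) (m := (k, 1)) (le_refl k)
    (le_refl 1) G x
  simp only [norm_iteratedFDeriv_one] at h
  exact ⟨_, le_trans (by positivity) (h 0), h⟩

lemma wsi_integrable_mul_fderiv (d : ℕ) (hd : 1 ≤ d) (α : ℝ) (hα0 : 0 < α) (hαd : α < (d : ℝ))
    (P Q : SchwartzMap (EuclideanSpace ℝ (Fin d)) ℂ) :
    Integrable (fun x => Complex.ofReal (‖x‖ ^ (-α)) * (P x * fderiv ℝ Q x x)) := by
  obtain ⟨C, hC0, hC⟩ := wsi_decay0 P 0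
  obtain ⟨C', hC0', hC'⟩ := wsi_decay1 Q (d + 2)
  refine wsi_integrable d hd α hα0 hαd _ ?_ (C * C') ?_
  · have h1 : Continuous (fderiv ℝ Q) := (Q.smooth 1).continuous_fderiv one_ne_zero
    exact P.continuous.mul (h1.clm_apply continuous_id)
  · intro x
    have h1 : ‖P x‖ ≤ C := by simpa using hC x
    have h2 : ‖fderiv ℝ Q x x‖ ≤ ‖fderiv ℝ Q x‖ * (1 + ‖x‖) :=
      (ContinuousLinearMap.le_opNorm _ _).trans (by gcongr; linarith)
    calc (1 + ‖x‖) ^ (d + 1) * ‖P x * fderiv ℝ Q x x‖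
        = ‖P x‖ * ((1 + ‖x‖) ^ (d + 1) * ‖fderiv ℝ Q x x‖) := by rw [norm_mul]; ring
      _ ≤ C * ((1 + ‖x‖) ^ (d + 1) * (‖fderiv ℝ Q x‖ * (1 + ‖x‖))) := by gcongr
      _ = C * ((1 + ‖x‖) ^ (d + 2) * ‖fderiv ℝ Q x‖) := by ring
      _ ≤ C * C' := by gcongr; exact hC' x

lemma wsi_scaling (d : ℕ) (α : ℝ) (G : EuclideanSpace ℝ (Fin d) → ℂ) (t : ℝ) (ht : 0 < t) :
    ∫ x, Complex.ofReal (‖x‖ ^ (-α)) * G (t • x)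
      = (t ^ (α - d)) • ∫ x, Complex.ofReal (‖x‖ ^ (-α)) * G x := by
  have h := Measure.integral_comp_smul_of_nonneg
    (volume : Measure (EuclideanSpace ℝ (Fin d)))
    (fun x => Complex.ofReal (‖x‖ ^ (-α)) * G x) t (hR := ht.le)
  rw [finrank_euclideanSpace_fin] at h
  have h2 : ∀ x : EuclideanSpace ℝ (Fin d), Complex.ofReal (‖x‖ ^ (-α)) * G (t • x)
      = (t ^ α) • (Complex.ofReal (‖t • x‖ ^ (-α)) * G (t • x)) := by
    intro x
    rw [norm_smul, Real.norm_of_nonneg ht.le, Real.mul_rpow ht.le (norm_nonneg _),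
      Complex.real_smul, ← mul_assoc, ← Complex.ofReal_mul, ← mul_assoc, ← Real.rpow_add ht]
    simp
  simp_rw [h2]
  rw [integral_smul, h, smul_smul, Real.rpow_sub ht, Real.rpow_natCast, div_eq_mul_inv]

lemma wsi_main (d : ℕ) (hd : 1 ≤ d) (α : ℝ) (hα0 : 0 < α) (hαd : α < (d : ℝ))
    (G : SchwartzMap (EuclideanSpace ℝ (Fin d)) ℂ) :
    ∫ x, Complex.ofReal (‖x‖ ^ (-α)) * fderiv ℝ G x x
      = (α - d) • ∫ x, Complex.ofReal (‖x‖ ^ (-α)) * G x := by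
  obtain ⟨C, hC0, hC⟩ := wsi_decay0 G (d + 1)
  obtain ⟨C', hC0', hC'⟩ := wsi_decay1 G (d + 2)
  have hcf : Continuous (fderiv ℝ G) := (G.smooth 1).continuous_fderiv one_ne_zero
  have key := hasDerivAt_integral_of_dominated_loc_of_deriv_le
    (μ := (volume : Measure (EuclideanSpace ℝ (Fin d)))) (𝕜 := ℝ) (x₀ := (1 : ℝ))
    (s := Metric.ball (1 : ℝ) (1 / 2))
    (F := fun t x => Complex.ofReal (‖x‖ ^ (-α)) * G (t • x))
    (F' := fun t x => Complex.ofReal (‖x‖ ^ (-α)) * fderiv ℝ G (t • x) x)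
    (bound := fun x => (‖x‖ ^ (-α) * ((1 + ‖x‖) ^ (d + 1))⁻¹) * (2 ^ (d + 2) * C'))
    (Metric.ball_mem_nhds _ (by norm_num)) ?_ ?_ ?_ ?_ ?_ ?_
  · have h1 := key.2
    have h2 : HasDerivAt (fun t : ℝ => ∫ x, Complex.ofReal (‖x‖ ^ (-α)) * G (t • x))
        ((α - d) • ∫ x, Complex.ofReal (‖x‖ ^ (-α)) * G x) 1 := by
      have h3 : HasDerivAt (fun t : ℝ => t ^ (α - d)) (α - d) 1 := by
        simpa using Real.hasDerivAt_rpow_const (x := 1) (p := α - d) (Or.inl one_ne_zero)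
      refine (h3.smul_const (∫ x, Complex.ofReal (‖x‖ ^ (-α)) * G x)).congr_of_eventuallyEq ?_
      filter_upwards [lt_mem_nhds (zero_lt_one' ℝ)] with t ht
      exact wsi_scaling d α G t ht
    simpa using h1.unique h2
  · refine Filter.Eventually.of_forall fun t => ?_
    have : Continuous fun x : EuclideanSpace ℝ (Fin d) => G (t • x) :=
      G.continuous.comp (continuous_const_smul t)
    refine (Measurable.mul ?_ this.measurable).aestronglyMeasurable
    fun_prop
  · simp only [one_smul]
    exact wsi_integrable d hd α hα0 hαd G G.continuous C hC
  · simp only [one_smul]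
    refine (Measurable.mul ?_ (hcf.clm_apply continuous_id).measurable).aestronglyMeasurable
    fun_prop
  · refine Filter.Eventually.of_forall fun x t ht => ?_
    rw [Metric.mem_ball, Real.dist_eq, abs_lt] at ht
    have ht0 : 1 / 2 < t := by linarith [ht.1]
    rw [norm_mul, Complex.norm_real, Real.norm_of_nonneg (by positivity), mul_assoc]
    gcongr
    rw [le_inv_mul_iff₀ (by positivity)]
    have h2 : ‖fderiv ℝ G (t • x) x‖ ≤ ‖fderiv ℝ G (t • x)‖ * (1 + ‖x‖) :=
      (ContinuousLinearMap.le_opNorm _ _).trans (by gcongr; linarith)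
    have h3 : 1 + ‖x‖ ≤ 2 * (1 + ‖t • x‖) := by
      rw [norm_smul, Real.norm_of_nonneg (by linarith)]
      nlinarith [norm_nonneg x]
    calc (1 + ‖x‖) ^ (d + 1) * ‖fderiv ℝ G (t • x) x‖
        ≤ (1 + ‖x‖) ^ (d + 1) * (‖fderiv ℝ G (t • x)‖ * (1 + ‖x‖)) := by gcongr
      _ = (1 + ‖x‖) ^ (d + 2) * ‖fderiv ℝ G (t • x)‖ := by ring
      _ ≤ (2 * (1 + ‖t • x‖)) ^ (d + 2) * ‖fderiv ℝ G (t • x)‖ := by gcongr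
      _ = 2 ^ (d + 2) * ((1 + ‖t • x‖) ^ (d + 2) * ‖fderiv ℝ G (t • x)‖) := by
        rw [mul_pow]; ring
      _ ≤ 2 ^ (d + 2) * C' := by gcongr; exact hC' _
  · exact (wsi_weight_integrable d hd α hα0 hαd).mul_const _
  · refine Filter.Eventually.of_forall fun x t _ => ?_
    have h1 : HasFDerivAt G (fderiv ℝ G (t • x)) (t • x) :=
      (G.differentiableAt).hasFDerivAt
    have h2 : HasDerivAt (fun t : ℝ => t • x) x t := by
      simpa using (hasDerivAt_id t).smul_const x
    exact (h1.comp_hasDerivAt t h2).const_mul _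

/-- Weighted scaling (dilation) identity used in the Pohozaev argument. -/
theorem weighted_scaling_identity
    (d : ℕ) (hd : 1 ≤ d) (α : ℝ) (hα0 : 0 < α) (hαd : α < (d : ℝ))
    (φ ψ : SchwartzMap (EuclideanSpace ℝ (Fin d)) ℂ) :
    2 * (∫ x, Complex.ofReal (‖x‖ ^ (-α)) * (starRingEnd ℂ) (φ x) * ψ x *
          fderiv ℝ (fun y => (starRingEnd ℂ) (φ y)) x x).re
      + (∫ x, Complex.ofReal (‖x‖ ^ (-α)) * (φ x) ^ 2 *
          fderiv ℝ (fun y => (starRingEnd ℂ) (ψ y)) x x).re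
      = -((d : ℝ) - α) *
          (∫ x, Complex.ofReal (‖x‖ ^ (-α)) * (φ x) ^ 2 * (starRingEnd ℂ) (ψ x)).re := by
  let B := ContinuousLinearMap.mul ℝ ℂ
  let Φ : SchwartzMap (EuclideanSpace ℝ (Fin d)) ℂ :=
    φ.postcompCLM (Complex.conjCLE : ℂ →L[ℝ] ℂ)
  have hΦ : ∀ x, Φ x = (starRingEnd ℂ) (φ x) := fun x => rfl
  have hΦ' : (fun y => (starRingEnd ℂ) (φ y)) = (Φ : EuclideanSpace ℝ (Fin d) → ℂ) := rfl
  let P := pairing B Φ ψ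
  let Q := pairing B Φ Φ
  let G := pairing B Q ψ
  have hP : ∀ x, P x = Φ x * ψ x := fun x => rfl
  have hQ : ∀ x, Q x = Φ x * Φ x := fun x => rfl
  have hG : ∀ x, G x = Φ x * Φ x * ψ x := fun x => rfl
  have hfG : ∀ x, fderiv ℝ G x x = 2 * (P x * fderiv ℝ Φ x x) + Q x * fderiv ℝ ψ x x := by
    intro x
    have h1 : HasFDerivAt Φ (fderiv ℝ Φ x) x := Φ.differentiableAt.hasFDerivAt
    have h2 : HasFDerivAt ψ (fderiv ℝ ψ x) x := ψ.differentiableAt.hasFDerivAt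
    have h3 : HasFDerivAt G _ x := (h1.mul h1).mul h2
    rw [h3.fderiv, hP, hQ]
    simp
    ring
  have hfψ : ∀ x, fderiv ℝ (fun y => (starRingEnd ℂ) (ψ y)) x x
      = (starRingEnd ℂ) (fderiv ℝ ψ x x) := by
    intro x
    have h2 : HasFDerivAt ψ (fderiv ℝ ψ x) x := ψ.differentiableAt.hasFDerivAt
    have h3 : HasFDerivAt (fun y => (starRingEnd ℂ) (ψ y)) _ x :=
      (Complex.conjCLE : ℂ →L[ℝ] ℂ).hasFDerivAt.comp x h2
    rw [h3.fderiv]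
    simp
  have e1 : (∫ x, Complex.ofReal (‖x‖ ^ (-α)) * (starRingEnd ℂ) (φ x) * ψ x *
          fderiv ℝ (fun y => (starRingEnd ℂ) (φ y)) x x)
      = ∫ x, Complex.ofReal (‖x‖ ^ (-α)) * (P x * fderiv ℝ Φ x x) := by
    congr 1
    ext x
    rw [hΦ', hP, hΦ]
    ring
  have e2 : (∫ x, Complex.ofReal (‖x‖ ^ (-α)) * (φ x) ^ 2 *
          fderiv ℝ (fun y => (starRingEnd ℂ) (ψ y)) x x)
      = (starRingEnd ℂ) (∫ x, Complex.ofReal (‖x‖ ^ (-α)) * (Q x * fderiv ℝ ψ x x)) := by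
    rw [← integral_conj]
    congr 1
    ext x
    rw [hfψ, hQ, hΦ]
    simp only [map_mul, Complex.conj_ofReal, Complex.conj_conj]
    ring
  have e3 : (∫ x, Complex.ofReal (‖x‖ ^ (-α)) * (φ x) ^ 2 * (starRingEnd ℂ) (ψ x))
      = (starRingEnd ℂ) (∫ x, Complex.ofReal (‖x‖ ^ (-α)) * G x) := by
    rw [← integral_conj]
    congr 1
    ext x
    rw [hG, hΦ]
    simp only [map_mul, Complex.conj_ofReal, Complex.conj_conj]
    ring
  have hmain := wsi_main d hd α hα0 hαd G
  have hsplit : (∫ x, Complex.ofReal (‖x‖ ^ (-α)) * fderiv ℝ G x x)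
      = 2 * (∫ x, Complex.ofReal (‖x‖ ^ (-α)) * (P x * fderiv ℝ Φ x x))
        + ∫ x, Complex.ofReal (‖x‖ ^ (-α)) * (Q x * fderiv ℝ ψ x x) := by
    rw [← integral_const_mul, ← integral_add
      ((wsi_integrable_mul_fderiv d hd α hα0 hαd P Φ).const_mul 2)
      (wsi_integrable_mul_fderiv d hd α hα0 hαd Q ψ)]
    congr 1
    ext x
    rw [hfG]
    ring
  rw [hsplit] at hmain
  have hre := congrArg Complex.re hmain
  rw [e1, e2, e3, Complex.conj_re, Complex.conj_re]
  rw [Complex.smul_re, Complex.add_re, smul_eq_mul] at hre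
  have h2 : ∀ z : ℂ, (2 * z).re = 2 * z.re := fun z => by simp
  rw [h2] at hre
  rw [hre]
  ring

end
end

section
/- Existence of admissible exponents (Lemma 6.1): Let d be an integer with 2 ≤ d ≤ 5 and let α be a real number with 0 < α < 2 and (4−d)/2 < α < (6−d)/2, and set s_c = d/2 − 2 + α. Then there exists θ > 0 such that, defining q = 4/(2−θ), r = 2d/(d−2+θ), q̄ = 4(2−θ)/(d−2+2α−θ(d−5+2α)), r̄ = 2d(2−θ)/(d+2−2α−θ(5−2α)), ā = 4(2−θ)/(6−d−2α+θ), ã = 2(3−θ)/(2d−6+4α−θ(d−4+2α)), â = 2(3−θ)/(6−d−2α), r̂ = d(3−θ)/(d−α−θ(2−α)), and m̄₊ = d/(2−α−dθ), m̄₋ = d/(2−α+dθ), the following hold: (q,r) and (q̄,r̄) are Ḣ⁰-admissible, (ā,r̄) and (â,r̂) are Ḣ^{s_c}-admissible, (ã,r̂) is Ḣ^{−s_c}-admissible, and 2 < m̄₊, m̄₋ with m̄₊, m̄₋ < 2d/(d−2) when d ≥ 3 (no upper bound required when d = 2). -/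
/-- A pair `(q, r)` is `Ḣˢ`-admissible in dimension `d`:
`2/q + d/r = d/2 − s` together with the range condition on `r`
(`2d/(d−2s) < r < 2d/(d−2)` if `d ≥ 3`, and `2/(1−s) < r` if `d = 2`). -/
def HsAdmissible (d : ℕ) (s q r : ℝ) : Prop :=
  2 / q + (d : ℝ) / r = (d : ℝ) / 2 - s ∧
  (if 3 ≤ d then 2 * (d : ℝ) / ((d : ℝ) - 2 * s) < r ∧ r < 2 * (d : ℝ) / ((d : ℝ) - 2)
   else 2 / (1 - s) < r)

/-- A pair `(q, r)` is `Ḣ^{−s}`-admissible in dimension `d`: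
`2/q + d/r = d/2 + s` together with the same range condition on `r`. -/
def HsNegAdmissible (d : ℕ) (s q r : ℝ) : Prop :=
  2 / q + (d : ℝ) / r = (d : ℝ) / 2 + s ∧
  (if 3 ≤ d then 2 * (d : ℝ) / ((d : ℝ) - 2 * s) < r ∧ r < 2 * (d : ℝ) / ((d : ℝ) - 2)
   else 2 / (1 - s) < r)

set_option maxHeartbeats 4000000 in
/-- Existence of admissible exponents (Lemma 6.1). -/
theorem exists_admissible_exponents
    (d : ℕ) (hd2 : 2 ≤ d) (hd5 : d ≤ 5) (α : ℝ)
    (hα0 : 0 < α) (hα2 : α < 2)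
    (hαl : (4 - (d : ℝ)) / 2 < α) (hαu : α < (6 - (d : ℝ)) / 2)
    (sc : ℝ) (hsc : sc = (d : ℝ) / 2 - 2 + α) :
    ∃ θ > 0,
      HsAdmissible d 0 (4 / (2 - θ)) (2 * (d : ℝ) / ((d : ℝ) - 2 + θ)) ∧
      HsAdmissible d 0
        (4 * (2 - θ) / ((d : ℝ) - 2 + 2 * α - θ * ((d : ℝ) - 5 + 2 * α)))
        (2 * (d : ℝ) * (2 - θ) / ((d : ℝ) + 2 - 2 * α - θ * (5 - 2 * α))) ∧
      HsAdmissible d sc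
        (4 * (2 - θ) / (6 - (d : ℝ) - 2 * α + θ))
        (2 * (d : ℝ) * (2 - θ) / ((d : ℝ) + 2 - 2 * α - θ * (5 - 2 * α))) ∧
      HsAdmissible d sc
        (2 * (3 - θ) / (6 - (d : ℝ) - 2 * α))
        ((d : ℝ) * (3 - θ) / ((d : ℝ) - α - θ * (2 - α))) ∧
      HsNegAdmissible d sc
        (2 * (3 - θ) / (2 * (d : ℝ) - 6 + 4 * α - θ * ((d : ℝ) - 4 + 2 * α)))
        ((d : ℝ) * (3 - θ) / ((d : ℝ) - α - θ * (2 - α))) ∧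
      2 < (d : ℝ) / (2 - α - (d : ℝ) * θ) ∧
      2 < (d : ℝ) / (2 - α + (d : ℝ) * θ) ∧
      (3 ≤ d →
        (d : ℝ) / (2 - α - (d : ℝ) * θ) < 2 * (d : ℝ) / ((d : ℝ) - 2) ∧
        (d : ℝ) / (2 - α + (d : ℝ) * θ) < 2 * (d : ℝ) / ((d : ℝ) - 2)) := by
  obtain ⟨θ, hθ, h1, h2, h3⟩ : ∃ θ : ℝ, 0 < θ ∧ 20 * θ < (d : ℝ) - 4 + 2 * α ∧
      20 * θ < 6 - (d : ℝ) - 2 * α ∧ 20 * θ < 2 - α := by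
    have e1 : 0 < (d : ℝ) - 4 + 2 * α := by linarith
    have e2 : 0 < 6 - (d : ℝ) - 2 * α := by linarith
    have e3 : 0 < 2 - α := by linarith
    have hm : 0 < min ((d : ℝ) - 4 + 2 * α) (min (6 - (d : ℝ) - 2 * α) (2 - α)) :=
      lt_min e1 (lt_min e2 e3)
    have m1 := min_le_left ((d : ℝ) - 4 + 2 * α) (min (6 - (d : ℝ) - 2 * α) (2 - α))
    have m2 := min_le_right ((d : ℝ) - 4 + 2 * α) (min (6 - (d : ℝ) - 2 * α) (2 - α))
    have m3 := min_le_left (6 - (d : ℝ) - 2 * α) (2 - α)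
    have m4 := min_le_right (6 - (d : ℝ) - 2 * α) (2 - α)
    exact ⟨min ((d : ℝ) - 4 + 2 * α) (min (6 - (d : ℝ) - 2 * α) (2 - α)) / 40,
      by linarith, by linarith, by linarith, by linarith⟩
  have hp0 : 0 < θ * α := mul_pos hθ hα0
  have hp2 : θ * α < θ * 2 := mul_lt_mul_of_pos_left hα2 hθ
  have n2 : (2 : ℝ) - θ ≠ 0 := by intro h; linarith
  have n3 : (3 : ℝ) - θ ≠ 0 := by intro h; linarith
  subst hsc
  refine ⟨θ, hθ, ?_⟩
  unfold HsAdmissible HsNegAdmissible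
  interval_cases d <;> norm_num at * <;>
  refine ⟨⟨?_, ?_⟩, ⟨?_, ?_⟩, ⟨?_, ?_⟩, ⟨?_, ?_⟩, ⟨?_, ?_⟩, ?_⟩ <;>
  (try simp only [div_div_eq_mul_div]) <;>
  first
  | (field_simp
     ring1)
  | (repeat' apply And.intro
     all_goals
       first
       | (rw [div_lt_div_iff₀ (by nlinarith) (by nlinarith)] ; nlinarith)
       | (rw [lt_div_iff₀ (by nlinarith)] ; nlinarith)
       | (rw [div_lt_iff₀ (by nlinarith)] ; nlinarith))
end

section
/- Weighted bilinear estimate (Lemma 6.3, inequality (non-est-4)): Let d be an integer with 3 ≤ d ≤ 5, let α be a real number with 0 < α < 2 and (4−d)/2 < α < (6−d)/2, and let m be a real number with 2d/(d+4) < m < 2d/(d+2). Then there exists a constant C > 0 such that for all Schwartz functions u, v : ℝ^d → ℂ one has ‖ |x|^{−α} conj(u) v ‖_{L^m} ≤ C ( ‖u‖_{L²} + ‖∇u‖_{L²} ) ( ‖v‖_{L²} + ‖∇v‖_{L²} ). -/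
open MeasureTheory SchwartzMap

noncomputable section

/-- The `L²` norm `(∫ ‖f x‖²)^{1/2}` of a function on `ℝ^d`. -/
def L2norm {d : ℕ} (f : EuclideanSpace ℝ (Fin d) → ℂ) : ℝ :=
  (∫ x, ‖f x‖ ^ 2) ^ ((1 : ℝ) / 2)

/-- The `L²` norm `(∫ ‖∇f x‖²)^{1/2}` of the gradient of a function on `ℝ^d`. -/
def gradL2norm {d : ℕ} (f : EuclideanSpace ℝ (Fin d) → ℂ) : ℝ :=
  (∫ x, ‖fderiv ℝ f x‖ ^ 2) ^ ((1 : ℝ) / 2)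

open scoped ENNReal NNReal in
lemma aux_interp {X : Type*} [MeasurableSpace X] {μ : Measure X} {f : X → ℂ}
    (hf : AEStronglyMeasurable f μ) {p s : ℝ} (hp : 2 ≤ p) (hps : p ≤ s) {N : ℝ≥0∞}
    (h2 : eLpNorm f 2 μ ≤ N) (hs : eLpNorm f (ENNReal.ofReal s) μ ≤ N) :
    eLpNorm f (ENNReal.ofReal p) μ ≤ N := by
  have key : ∀ t : ℝ, 0 < t → (eLpNorm f (ENNReal.ofReal t) μ ≤ N ↔
      ∫⁻ x, ‖f x‖ₑ ^ t ∂μ ≤ N ^ t) := by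
    intro t ht
    rw [eLpNorm_eq_lintegral_rpow_enorm_toReal (by simpa using ht) (by simp),
      ENNReal.toReal_ofReal ht.le, one_div, ENNReal.rpow_inv_le_iff ht]
  have h2' : eLpNorm f (ENNReal.ofReal 2) μ ≤ N := by simpa using h2
  rcases eq_or_lt_of_le (hp.trans hps) with h | h
  · have : p = s := le_antisymm hps (by linarith)
    rwa [this]
  rw [key _ (by linarith)] at hs h2' ⊢
  have hs2 : 0 < s - 2 := by linarith
  set a := (s - p) / (s - 2) with ha
  set b := (p - 2) / (s - 2) with hb
  have ha0 : 0 ≤ a := div_nonneg (by linarith) hs2.le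
  have hb0 : 0 ≤ b := div_nonneg (by linarith) hs2.le
  have hab : a + b = 1 := by rw [ha, hb]; field_simp; ring
  have hp' : 2 * a + s * b = p := by rw [ha, hb]; field_simp; ring
  have hs0 : 0 ≤ s := by linarith
  calc ∫⁻ x, ‖f x‖ₑ ^ p ∂μ
      = ∫⁻ x, (‖f x‖ₑ ^ (2:ℝ)) ^ a * (‖f x‖ₑ ^ s) ^ b ∂μ := by
        refine lintegral_congr fun x => ?_
        rw [← ENNReal.rpow_mul, ← ENNReal.rpow_mul, ← ENNReal.rpow_add_of_nonneg _ _
          (by positivity) (by positivity), hp']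
    _ ≤ (∫⁻ x, ‖f x‖ₑ ^ (2:ℝ) ∂μ) ^ a * (∫⁻ x, ‖f x‖ₑ ^ s ∂μ) ^ b :=
        ENNReal.lintegral_mul_norm_pow_le (hf.enorm.pow_const _) (hf.enorm.pow_const _) ha0 hb0 hab
    _ ≤ (N ^ (2:ℝ)) ^ a * (N ^ s) ^ b := by gcongr
    _ = N ^ p := by
        rw [← ENNReal.rpow_mul, ← ENNReal.rpow_mul, ← ENNReal.rpow_add_of_nonneg _ _
          (by positivity) (by positivity), hp']

open scoped ENNReal NNReal in
lemma aux_sobolev (d : ℕ) (hd3 : 3 ≤ d) :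
    ∃ C : ℝ≥0, ∀ u : SchwartzMap (EuclideanSpace ℝ (Fin d)) ℂ,
      eLpNorm u (ENNReal.ofReal (2 * d / (d - 2))) volume ≤
        C * (eLpNorm u 2 volume + eLpNorm (fderiv ℝ u) 2 volume) := by
  let E := EuclideanSpace ℝ (Fin d)
  have hd : (3:ℝ) ≤ d := by exact_mod_cast hd3
  let φ : ContDiffBump (0 : E) := ⟨1, 2, one_pos, one_lt_two⟩
  have hφ : ContDiff ℝ 1 φ := φ.contDiff
  obtain ⟨B, hB⟩ : ∃ B, ∀ x, ‖fderiv ℝ φ x‖ ≤ B :=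
    (φ.hasCompactSupport.fderiv ℝ).exists_bound_of_continuous (hφ.continuous_fderiv (by norm_num))
  have hB0 : 0 ≤ B := (norm_nonneg _).trans (hB 0)
  let K : ℝ≥0 := eLpNormLESNormFDerivOfEqInnerConst (volume : Measure E) ((2 : ℝ≥0) : ℝ)
  refine ⟨K * (1 + B.toNNReal), fun u => ?_⟩
  let c : ℕ → ℝ := fun n => (1 / ((n : ℝ) + 1))
  have hc0 : ∀ n, 0 < c n := fun n => by positivity
  have hc1 : ∀ n, c n ≤ 1 := fun n => by
    simp only [c]; rw [div_le_one (by positivity)]; linarith [(Nat.cast_nonneg n : (0:ℝ) ≤ n)]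
  let w : ℕ → E → ℂ := fun n x => φ (c n • x) • u x
  have hψ : ∀ n, ContDiff ℝ 1 (fun x : E => φ (c n • x)) := fun n =>
    hφ.comp (contDiff_const_smul _)
  have hu1 : ContDiff ℝ 1 u := u.smooth 1
  have hw : ∀ n, ContDiff ℝ 1 (w n) := fun n => (hψ n).smul hu1
  have hwc : ∀ n, HasCompactSupport (w n) := fun n => by
    have : HasCompactSupport (fun x : E => φ (c n • x)) :=
      φ.hasCompactSupport.comp_smul (hc0 n).ne'
    exact this.smul_right
  have hb : ∀ n x, ‖fderiv ℝ (w n) x‖ ≤ ‖fderiv ℝ u x‖ + B * ‖u x‖ := by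
    intro n x
    have : fderiv ℝ (w n) x = φ (c n • x) • fderiv ℝ u x +
        (fderiv ℝ (fun x : E => φ (c n • x)) x).smulRight (u x) :=
      fderiv_fun_smul ((hψ n).differentiable (by norm_num) x) (hu1.differentiable (by norm_num) x)
    rw [this, fderiv_comp_smul]
    refine (norm_add_le _ _).trans ?_
    rw [norm_smul, ContinuousLinearMap.norm_smulRight_apply, norm_smul,
      Real.norm_of_nonneg (hc0 n).le, Real.norm_of_nonneg φ.nonneg]
    gcongr
    · exact mul_le_of_le_one_left (norm_nonneg _) φ.le_one
    · exact (mul_le_of_le_one_left (norm_nonneg _) (hc1 n)).trans (hB _)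
  have hum : AEStronglyMeasurable u (volume : Measure E) := hu1.continuous.aestronglyMeasurable
  have hdm : AEStronglyMeasurable (fderiv ℝ u) (volume : Measure E) :=
    (hu1.continuous_fderiv (by norm_num)).aestronglyMeasurable
  have hgrad : ∀ n, eLpNorm (fderiv ℝ (w n)) 2 volume ≤
      (1 + B.toNNReal : ℝ≥0) * (eLpNorm u 2 volume + eLpNorm (fderiv ℝ u) 2 volume) := by
    intro n
    calc eLpNorm (fderiv ℝ (w n)) 2 volume
        ≤ eLpNorm ((fun x => ‖fderiv ℝ u x‖) + fun x => B * ‖u x‖) 2 volume := by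
          refine eLpNorm_mono_real fun x => ?_
          exact hb n x
      _ ≤ eLpNorm (fun x => ‖fderiv ℝ u x‖) 2 volume + eLpNorm (fun x => B * ‖u x‖) 2 volume :=
          eLpNorm_add_le hdm.norm (hum.norm.const_mul _) (by norm_num)
      _ ≤ eLpNorm (fderiv ℝ u) 2 volume + ENNReal.ofReal B * eLpNorm u 2 volume := by
          gcongr
          · rw [eLpNorm_norm]
          · refine eLpNorm_le_mul_eLpNorm_of_ae_le_mul (.of_forall fun x => ?_) _
            simp [abs_of_nonneg hB0]
      _ ≤ _ := by
          push_cast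
          change _ + (B.toNNReal : ℝ≥0∞) * _ ≤ _
          rw [add_mul, mul_add, mul_add, one_mul, one_mul]
          calc _ ≤ eLpNorm (fderiv ℝ u) 2 volume + B.toNNReal * eLpNorm u 2 volume
                + (eLpNorm u 2 volume + B.toNNReal * eLpNorm (fderiv ℝ u) 2 volume) :=
                  le_self_add
            _ = _ := by ring
  have hsob : ∀ n, eLpNorm (w n) (ENNReal.ofReal (2 * d / (d - 2))) volume ≤
      K * eLpNorm (fderiv ℝ (w n)) 2 volume := by
    intro n
    have := eLpNorm_le_eLpNorm_fderiv_of_eq_inner (volume : Measure E) (hw n) (hwc n)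
      (p := 2) (p' := (2 * d / (d - 2) : ℝ).toNNReal) (by norm_num)
      (by simp [E]; omega) (by
        have : (0:ℝ) < d - 2 := by linarith
        rw [Real.coe_toNNReal _ (by positivity)]
        simp only [E, finrank_euclideanSpace, Fintype.card_fin]
        push_cast
        field_simp)
    exact this
  have hlim := Lp.eLpNorm_lim_le_liminf_eLpNorm (p := ENNReal.ofReal (2 * d / (d - 2)))
    (μ := (volume : Measure E)) (f := w) (fun n => (hw n).continuous.aestronglyMeasurable) u
    (.of_forall fun x => by
      have h1 : Filter.Tendsto (fun n => φ (c n • x)) Filter.atTop (nhds (1:ℝ)) := by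
        have h2 : Filter.Tendsto (fun n => c n • x) Filter.atTop (nhds (0 : E)) := by
          simpa [c] using (tendsto_one_div_add_atTop_nhds_zero_nat (𝕜 := ℝ)).smul_const x
        have h3 := (φ.continuous.tendsto 0).comp h2
        rwa [φ.one_of_mem_closedBall (by simp [φ])] at h3
      simpa [w] using h1.smul_const (u x))
  refine hlim.trans ?_
  refine Filter.liminf_le_of_le (by isBoundedDefault) fun b hb' => ?_
  obtain ⟨n, hn⟩ := hb'.exists
  refine hn.trans ((hsob n).trans ?_)
  push_cast
  rw [mul_assoc]
  gcongr
  simpa using hgrad n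

open scoped ENNReal NNReal in
lemma aux_near (d : ℕ) (hd3 : 3 ≤ d) (α r : ℝ) (hr : 0 < r) (h : α * r < d) :
    MemLp ((Metric.ball (0 : EuclideanSpace ℝ (Fin d)) 1).indicator fun x => ‖x‖ ^ (-α))
      (ENNReal.ofReal r) volume := by
  have : Nontrivial (EuclideanSpace ℝ (Fin d)) :=
    Module.nontrivial_of_finrank_pos (R := ℝ) (by simp; omega)
  rw [← integrable_norm_rpow_iff (by
    refine (Measurable.indicator ?_ measurableSet_ball).aestronglyMeasurable
    fun_prop) (by simpa using hr) (by simp), ENNReal.toReal_ofReal hr.le]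
  let f : ℝ → ℝ := (Set.Iio 1).indicator fun y => |y ^ (-α)| ^ r
  have e : (fun x : EuclideanSpace ℝ (Fin d) =>
      ‖(Metric.ball (0 : EuclideanSpace ℝ (Fin d)) 1).indicator (fun x => ‖x‖ ^ (-α)) x‖ ^ r)
      = fun x => f ‖x‖ := by
    funext x
    by_cases hx : ‖x‖ < 1
    · simp [f, hx]
    · simp [f, hx, hr.ne']
  rw [e, integrable_fun_norm_addHaar, finrank_euclideanSpace, Fintype.card_fin]
  have h1 : IntegrableOn (fun y : ℝ => y ^ ((d:ℝ) - 1 - α * r)) (Set.Ioo 0 1) :=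
    (intervalIntegral.integrableOn_Ioo_rpow_iff one_pos).2 (by linarith)
  have h2 : IntegrableOn ((Set.Iio 1).indicator fun y : ℝ => y ^ ((d:ℝ) - 1 - α * r))
      (Set.Ioi 0) := by
    rw [IntegrableOn, integrable_indicator_iff measurableSet_Iio, IntegrableOn,
      Measure.restrict_restrict measurableSet_Iio]
    rwa [Set.inter_comm, Set.Ioi_inter_Iio]
  refine h2.congr_fun (fun y hy => ?_) measurableSet_Ioi
  have hy : 0 < y := hy
  by_cases hy1 : y < 1
  · simp only [f, Set.indicator_of_mem (show y ∈ Set.Iio 1 from hy1), smul_eq_mul]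
    rw [abs_of_pos (by positivity), ← Real.rpow_mul hy.le, ← Real.rpow_natCast,
      ← Real.rpow_add hy, Nat.cast_sub (by omega)]
    congr 1; push_cast; ring
  · simp [f, hy1]

open scoped ENNReal NNReal in
lemma aux_far (d : ℕ) (hd3 : 3 ≤ d) (α r : ℝ) (hr : 0 < r) (h : d < α * r) :
    MemLp ((Metric.ball (0 : EuclideanSpace ℝ (Fin d)) 1)ᶜ.indicator fun x => ‖x‖ ^ (-α))
      (ENNReal.ofReal r) volume := by
  have : Nontrivial (EuclideanSpace ℝ (Fin d)) :=
    Module.nontrivial_of_finrank_pos (R := ℝ) (by simp; omega)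
  rw [← integrable_norm_rpow_iff (by
    refine (Measurable.indicator ?_ measurableSet_ball.compl).aestronglyMeasurable
    fun_prop) (by simpa using hr) (by simp), ENNReal.toReal_ofReal hr.le]
  let f : ℝ → ℝ := (Set.Ici 1).indicator fun y => |y ^ (-α)| ^ r
  have e : (fun x : EuclideanSpace ℝ (Fin d) =>
      ‖(Metric.ball (0 : EuclideanSpace ℝ (Fin d)) 1)ᶜ.indicator (fun x => ‖x‖ ^ (-α)) x‖ ^ r)
      = fun x => f ‖x‖ := by
    funext x
    by_cases hx : 1 ≤ ‖x‖
    · simp [f, hx]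
    · simp [f, hx, hr.ne']
  rw [e, integrable_fun_norm_addHaar, finrank_euclideanSpace, Fintype.card_fin]
  have h1 : IntegrableOn (fun y : ℝ => y ^ ((d:ℝ) - 1 - α * r)) (Set.Ici 1) :=
    (integrableOn_Ici_iff_integrableOn_Ioi (by simp)).2
      ((integrableOn_Ioi_rpow_iff one_pos).2 (by linarith))
  have h2 : IntegrableOn ((Set.Ici 1).indicator fun y : ℝ => y ^ ((d:ℝ) - 1 - α * r))
      (Set.Ioi 0) := by
    rw [IntegrableOn, integrable_indicator_iff measurableSet_Ici, IntegrableOn,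
      Measure.restrict_restrict measurableSet_Ici]
    exact h1.mono_set Set.inter_subset_left
  refine h2.congr_fun (fun y hy => ?_) measurableSet_Ioi
  have hy : 0 < y := hy
  by_cases hy1 : 1 ≤ y
  · simp only [f, Set.indicator_of_mem (show y ∈ Set.Ici 1 from hy1), smul_eq_mul]
    rw [abs_of_pos (by positivity), ← Real.rpow_mul hy.le, ← Real.rpow_natCast,
      ← Real.rpow_add hy, Nat.cast_sub (by omega)]
    congr 1; push_cast; ring
  · simp [f, hy1]

open scoped ENNReal NNReal in
lemma aux_far_top (d : ℕ) (α : ℝ) (h : 0 < α) :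
    MemLp ((Metric.ball (0 : EuclideanSpace ℝ (Fin d)) 1)ᶜ.indicator fun x => ‖x‖ ^ (-α))
      ∞ volume := by
  refine memLp_top_of_bound (by
    refine (Measurable.indicator ?_ measurableSet_ball.compl).aestronglyMeasurable
    fun_prop) 1 (.of_forall fun x => ?_)
  by_cases hx : 1 ≤ ‖x‖
  · rw [Set.indicator_of_mem (by simpa using hx), Real.norm_of_nonneg (by positivity)]
    exact Real.rpow_le_one_of_one_le_of_nonpos hx (by linarith)
  · simp [hx]

open scoped ENNReal NNReal in
lemma aux_piece (d : ℕ) (C : ℝ≥0) (hC1 : 1 ≤ C) (s : ℝ)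
    (hC : ∀ u : SchwartzMap (EuclideanSpace ℝ (Fin d)) ℂ,
      eLpNorm u (ENNReal.ofReal s) volume ≤
        C * (eLpNorm u 2 volume + eLpNorm (fderiv ℝ u) 2 volume))
    (w : EuclideanSpace ℝ (Fin d) → ℝ) (r : ℝ≥0∞) (q m : ℝ) (hw : MemLp w r volume)
    (hq : 1 ≤ q) (hqs : 2 * q ≤ s) (hm : r⁻¹ + (ENNReal.ofReal q)⁻¹ = (ENNReal.ofReal m)⁻¹)
    (u v : SchwartzMap (EuclideanSpace ℝ (Fin d)) ℂ) :
    eLpNorm (fun x => w x • ((starRingEnd ℂ) (u x) * v x)) (ENNReal.ofReal m) volume ≤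
      eLpNorm w r volume * ((C * (eLpNorm u 2 volume + eLpNorm (fderiv ℝ u) 2 volume)) *
        (C * (eLpNorm v 2 volume + eLpNorm (fderiv ℝ v) 2 volume))) := by
  have hint : ∀ u : SchwartzMap (EuclideanSpace ℝ (Fin d)) ℂ,
      eLpNorm u (ENNReal.ofReal (2 * q)) volume ≤
        C * (eLpNorm u 2 volume + eLpNorm (fderiv ℝ u) 2 volume) := fun u => by
    refine aux_interp u.continuous.aestronglyMeasurable (by linarith) hqs ?_ (hC u)
    have : (1 : ℝ≥0∞) ≤ C := by exact_mod_cast hC1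
    calc eLpNorm u 2 volume ≤ 1 * (eLpNorm u 2 volume + eLpNorm (fderiv ℝ u) 2 volume) := by
          rw [one_mul]; exact le_self_add
      _ ≤ _ := by gcongr
  have hcu : Continuous (fun x => (starRingEnd ℂ) (u x)) :=
    Complex.continuous_conj.comp u.continuous
  have : ENNReal.HolderTriple r (ENNReal.ofReal q) (ENNReal.ofReal m) := ⟨hm⟩
  have : ENNReal.HolderTriple (ENNReal.ofReal (2 * q)) (ENNReal.ofReal (2 * q))
      (ENNReal.ofReal q) := ⟨by
    rw [← ENNReal.ofReal_inv_of_pos (by linarith), ← ENNReal.ofReal_inv_of_pos (by linarith),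
      ← ENNReal.ofReal_add (by positivity) (by positivity)]
    congr 1; field_simp; norm_num⟩
  refine (eLpNorm_smul_le_mul_eLpNorm (p := r) (q := ENNReal.ofReal q)
    (hcu.mul v.continuous).aestronglyMeasurable hw.1).trans ?_
  gcongr
  refine (eLpNorm_smul_le_mul_eLpNorm (p := ENNReal.ofReal (2 * q)) (q := ENNReal.ofReal (2 * q))
    v.continuous.aestronglyMeasurable hcu.aestronglyMeasurable).trans ?_
  gcongr
  · refine le_trans (le_of_eq ?_) (hint u)
    exact eLpNorm_congr_norm_ae (.of_forall fun x => by simp)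
  · exact hint v

/-- Weighted bilinear estimate (Lemma 6.3, inequality (non-est-4)). -/
theorem weighted_bilinear_estimate
    (d : ℕ) (hd3 : 3 ≤ d) (hd5 : d ≤ 5) (α m : ℝ)
    (hα0 : 0 < α) (hα2 : α < 2)
    (hαl : (4 - (d : ℝ)) / 2 < α) (hαu : α < (6 - (d : ℝ)) / 2)
    (hm1 : 2 * (d : ℝ) / ((d : ℝ) + 4) < m) (hm2 : m < 2 * (d : ℝ) / ((d : ℝ) + 2)) :
    ∃ C > 0, ∀ u v : SchwartzMap (EuclideanSpace ℝ (Fin d)) ℂ,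
      (∫ x, ‖Complex.ofReal (‖x‖ ^ (-α)) * (starRingEnd ℂ) (u x) * v x‖ ^ m)
          ^ (1 / m) ≤
        C * (L2norm (⇑u) + gradL2norm (⇑u)) * (L2norm (⇑v) + gradL2norm (⇑v)) := by
  have hd3' : (3:ℝ) ≤ d := by exact_mod_cast hd3
  have hd5' : (d:ℝ) ≤ 5 := by exact_mod_cast hd5
  have hd2 : (0:ℝ) < d - 2 := by linarith
  have hd0 : (0:ℝ) < d := by linarith
  have hm0 : 0 < m := lt_trans (by positivity) hm1
  have hmi1 : ((d:ℝ) + 2) / (2 * d) < m⁻¹ := by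
    rw [lt_inv_comm₀ (by positivity) hm0, inv_div]; exact hm2
  have hmi2 : m⁻¹ < ((d:ℝ) + 4) / (2 * d) := by
    rw [inv_lt_comm₀ hm0 (by positivity), inv_div]; exact hm1
  obtain ⟨C₀, hC₀⟩ := aux_sobolev d hd3
  obtain ⟨C, hC1, hC⟩ : ∃ C : NNReal, 1 ≤ C ∧
      ∀ u : SchwartzMap (EuclideanSpace ℝ (Fin d)) ℂ,
      eLpNorm u (ENNReal.ofReal (2 * d / (d - 2))) volume ≤
        C * (eLpNorm u 2 volume + eLpNorm (fderiv ℝ u) 2 volume) :=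
    ⟨max C₀ 1, le_max_right _ _, fun u => (hC₀ u).trans (by gcongr; exact le_max_left _ _)⟩
  set w₁ := ((Metric.ball (0 : EuclideanSpace ℝ (Fin d)) 1).indicator fun x => ‖x‖ ^ (-α)) with hw₁
  set w₂ := ((Metric.ball (0 : EuclideanSpace ℝ (Fin d)) 1)ᶜ.indicator fun x => ‖x‖ ^ (-α)) with hw₂
  -- the near part
  obtain ⟨A₁, hA₁⟩ : ∃ A₁ : NNReal, ∀ u v : SchwartzMap (EuclideanSpace ℝ (Fin d)) ℂ,
      eLpNorm (fun x => w₁ x • ((starRingEnd ℂ) (u x) * v x)) (ENNReal.ofReal m) volume ≤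
      A₁ * ((C * (eLpNorm u 2 volume + eLpNorm (fderiv ℝ u) 2 volume)) *
        (C * (eLpNorm v 2 volume + eLpNorm (fderiv ℝ v) 2 volume))) := by
    have hk : α / d < m⁻¹ - (d - 2) / d := by
      have : α / d < ((d:ℝ) + 2) / (2 * d) - (d - 2) / d := by
        rw [div_sub_div _ _ (by positivity) (by positivity),
          div_lt_div_iff₀ (by positivity) (by positivity)]
        have : 0 < (6 - (d:ℝ)) / 2 - α := by linarith
        have : 0 < ((6 - (d:ℝ)) / 2 - α) * (d * d) := by positivity
        nlinarith
      linarith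
    have hk0 : 0 < m⁻¹ - (d - 2) / d := lt_trans (by positivity) hk
    have hmem := aux_near d hd3 α (m⁻¹ - (d - 2) / d)⁻¹ (by positivity) (by
      rw [← div_eq_mul_inv, div_lt_iff₀ hk0]
      rw [div_lt_iff₀ hd0] at hk
      linarith)
    refine ⟨_, fun u v => (aux_piece d C hC1 _ hC w₁ _ (d / (d - 2)) m hmem ?_ ?_ ?_ u v).trans
      (le_of_eq (by rw [ENNReal.coe_toNNReal hmem.2.ne]))⟩
    · rw [le_div_iff₀ hd2]; linarith
    · rw [mul_div_assoc]
    · rw [← ENNReal.ofReal_inv_of_pos (by positivity), ← ENNReal.ofReal_inv_of_pos (by positivity),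
        ← ENNReal.ofReal_inv_of_pos (by positivity), ← ENNReal.ofReal_add (by positivity)
        (by positivity), inv_inv, inv_div, sub_add_cancel]
  -- the far part
  obtain ⟨A₂, hA₂⟩ : ∃ A₂ : NNReal, ∀ u v : SchwartzMap (EuclideanSpace ℝ (Fin d)) ℂ,
      eLpNorm (fun x => w₂ x • ((starRingEnd ℂ) (u x) * v x)) (ENNReal.ofReal m) volume ≤
      A₂ * ((C * (eLpNorm u 2 volume + eLpNorm (fderiv ℝ u) 2 volume)) *
        (C * (eLpNorm v 2 volume + eLpNorm (fderiv ℝ v) 2 volume))) := by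
    rcases le_or_gt 1 m with h1m | h1m
    · have hmem := aux_far_top d α hα0
      refine ⟨_, fun u v => (aux_piece d C hC1 _ hC w₂ _ m m hmem h1m ?_ (by simp) u v).trans
        (le_of_eq (by rw [ENNReal.coe_toNNReal hmem.2.ne]))⟩
      rw [mul_div_assoc]
      have : m ≤ d / (d - 2) := by
        refine hm2.le.trans ?_
        rw [div_le_div_iff₀ (by positivity) hd2]
        nlinarith
      linarith
    · have hk0 : 0 < m⁻¹ - 1 := sub_pos.2 ((one_lt_inv₀ hm0).2 h1m)
      have hk : m⁻¹ - 1 < α / d := by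
        have : ((d:ℝ) + 4) / (2 * d) - 1 < α / d := by
          rw [div_sub_one (by positivity), div_lt_div_iff₀ (by positivity) (by positivity)]
          have : 0 < α - (4 - (d:ℝ)) / 2 := by linarith
          have : 0 < (α - (4 - (d:ℝ)) / 2) * d := by positivity
          nlinarith
        linarith
      have hmem := aux_far d hd3 α (m⁻¹ - 1)⁻¹ (by positivity) (by
        rw [← div_eq_mul_inv, lt_div_iff₀ hk0]
        rw [lt_div_iff₀ hd0] at hk
        linarith)
      refine ⟨_, fun u v => (aux_piece d C hC1 _ hC w₂ _ 1 m hmem le_rfl ?_ ?_ u v).trans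
        (le_of_eq (by rw [ENNReal.coe_toNNReal hmem.2.ne]))⟩
      · rw [le_div_iff₀ hd2]; linarith
      · rw [← ENNReal.ofReal_inv_of_pos (by positivity), ← ENNReal.ofReal_inv_of_pos (by positivity),
          ← ENNReal.ofReal_inv_of_pos (by positivity), ← ENNReal.ofReal_add (by positivity)
          (by positivity), inv_inv, inv_one, sub_add_cancel]
  have hLt : (ENNReal.ofReal m).LpAddConst ≠ ⊤ := (ENNReal.LpAddConst_lt_top _).ne
  set L : NNReal := (ENNReal.ofReal m).LpAddConst.toNNReal with hL
  -- real norms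
  have hH : ∀ u : SchwartzMap (EuclideanSpace ℝ (Fin d)) ℂ,
      eLpNorm u 2 volume + eLpNorm (fderiv ℝ u) 2 volume =
        ENNReal.ofReal (L2norm u + gradL2norm u) := by
    intro u
    have h1 : eLpNorm u 2 volume = ENNReal.ofReal (L2norm u) := by
      rw [(u.memLp 2 volume).eLpNorm_eq_integral_rpow_norm (by norm_num) (by norm_num)]
      simp [L2norm]
    have hmem : MemLp (fderiv ℝ u) 2 volume :=
      (SchwartzMap.fderivCLM ℝ (EuclideanSpace ℝ (Fin d)) ℂ u).memLp 2 volume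
    have h2 : eLpNorm (fderiv ℝ u) 2 volume = ENNReal.ofReal (gradL2norm u) := by
      rw [hmem.eLpNorm_eq_integral_rpow_norm (by norm_num) (by norm_num)]
      simp [gradL2norm]
    rw [h1, h2, ENNReal.ofReal_add] <;> simp only [L2norm, gradL2norm] <;> positivity
  have hN0 : ∀ u : SchwartzMap (EuclideanSpace ℝ (Fin d)) ℂ, 0 ≤ L2norm u + gradL2norm u :=
    fun u => by unfold L2norm gradL2norm; positivity
  refine ⟨L * (A₁ + A₂) * C * C + 1, by positivity, fun u v => ?_⟩
  have hcu : Continuous (fun x => (starRingEnd ℂ) (u x) * v x) :=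
    (Complex.continuous_conj.comp u.continuous).mul v.continuous
  have hm₁ : AEStronglyMeasurable w₁ volume := by
    refine (Measurable.indicator ?_ measurableSet_ball).aestronglyMeasurable
    fun_prop
  have hm₂ : AEStronglyMeasurable w₂ volume := by
    refine (Measurable.indicator ?_ measurableSet_ball.compl).aestronglyMeasurable
    fun_prop
  have hF₁ := hm₁.smul hcu.aestronglyMeasurable
  have hF₂ := hm₂.smul hcu.aestronglyMeasurable
  have hFeq : (fun x => Complex.ofReal (‖x‖ ^ (-α)) * (starRingEnd ℂ) (u x) * v x) =
      (fun x => w₁ x • ((starRingEnd ℂ) (u x) * v x)) +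
      (fun x => w₂ x • ((starRingEnd ℂ) (u x) * v x)) := by
    funext x
    have : w₁ x + w₂ x = ‖x‖ ^ (-α) := Set.indicator_self_add_compl_apply _ _ _
    rw [Pi.add_apply, ← add_smul, this, Complex.real_smul, mul_assoc]
  have hbound : eLpNorm (fun x => Complex.ofReal (‖x‖ ^ (-α)) * (starRingEnd ℂ) (u x) * v x)
      (ENNReal.ofReal m) volume ≤ ENNReal.ofReal (L * (A₁ + A₂) * C * C *
        (L2norm u + gradL2norm u) * (L2norm v + gradL2norm v)) := by
    rw [hFeq]
    refine (eLpNorm_add_le' hF₁ hF₂ _).trans ?_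
    have h := add_le_add (hA₁ u v) (hA₂ u v)
    rw [hH u, hH v] at h
    refine (mul_le_mul_right h _).trans (le_of_eq ?_)
    rw [← ENNReal.coe_toNNReal hLt, ← hL, ENNReal.ofReal_mul' (hN0 v), ENNReal.ofReal_mul' (hN0 u)]
    have : (L * (A₁ + A₂) * C * C : ℝ) = ((L * (A₁ + A₂) * C * C : NNReal) : ℝ) := by push_cast; rfl
    rw [this, ENNReal.ofReal_coe_nnreal]
    push_cast
    ring
  have hmemF : MemLp (fun x => Complex.ofReal (‖x‖ ^ (-α)) * (starRingEnd ℂ) (u x) * v x)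
      (ENNReal.ofReal m) volume :=
    ⟨by rw [hFeq]; exact hF₁.add hF₂, hbound.trans_lt ENNReal.ofReal_lt_top⟩
  rw [hmemF.eLpNorm_eq_integral_rpow_norm (by simpa using hm0) (by simp),
    ENNReal.toReal_ofReal hm0.le, ENNReal.ofReal_le_ofReal_iff (by
      have := hN0 u; have := hN0 v; positivity)] at hbound
  rw [one_div]
  refine hbound.trans ?_
  have h1 := hN0 u
  have h2 := hN0 v
  gcongr
  linarith

end
end
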